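/- arXiv:2303.00283 — 7 statements merged into one kernel-verified Lean document; each statement's English description precedes it below -/
import Mathlib

section
/- Let r > 0, θ, ṙ, θ̇ be real numbers, set l := r²·θ̇ and assume l > 0; set r₁ := r/l² and v := l·ṙ. Put u := r·exp(iθ) ∈ ℂ, u̇ := (ṙ + i·r·θ̇)·exp(iθ) ∈ ℂ, and define the complex eccentricity vector ℰ := −i·l·u̇ − u/|u|. Then: (i) u̇ = (v/l + i·l/r)·exp(iθ); (ii) exp(−iθ)·ℰ = (1−r₁)/r₁ − i·v; and (iii) H(r₁, v) = ½·|ℰ|², where H(r₁,v) := ½v² + (r₁−1)²/(2r₁²). -/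
/-- In the blown-up coordinates `r₁ = r/l²`, `v = l·ṙ` the complex eccentricity vector
`ℰ = -i·l·u̇ - u/|u|` satisfies `e^{-iθ}·ℰ = (1-r₁)/r₁ - i·v`, and
`H(r₁,v) = ½v² + (r₁-1)²/(2r₁²) = ½|ℰ|²`. -/
theorem eccentricity_blowup_coordinates
    (r θ rdot θdot l r₁ v : ℝ) (hr : 0 < r)
    (hl_def : l = r ^ 2 * θdot) (hl : 0 < l)
    (hr₁ : r₁ = r / l ^ 2) (hv : v = l * rdot)
    (u udot E : ℂ)
    (hu : u = (r : ℂ) * Complex.exp (Complex.I * θ))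
    (hudot : udot = ((rdot : ℂ) + Complex.I * r * θdot) * Complex.exp (Complex.I * θ))
    (hE : E = -Complex.I * l * udot - u / (‖u‖ : ℂ)) :
    udot = ((v / l : ℝ) + Complex.I * ((l / r : ℝ) : ℂ)) * Complex.exp (Complex.I * θ) ∧
    Complex.exp (-(Complex.I * θ)) * E = (((1 - r₁) / r₁ : ℝ) : ℂ) - Complex.I * (v : ℂ) ∧
    (1 / 2) * v ^ 2 + (r₁ - 1) ^ 2 / (2 * r₁ ^ 2) = (1 / 2) * ‖E‖ ^ 2 := by
  have hr0 : r ≠ 0 := hr.ne'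
  have hl0 : l ≠ 0 := hl.ne'
  have hexp : ‖Complex.exp (Complex.I * θ)‖ = 1 := by
    rw [mul_comm]; exact Complex.norm_exp_ofReal_mul_I θ
  have hexp' : ‖Complex.exp (-(Complex.I * θ))‖ = 1 := by
    rw [Complex.exp_neg, norm_inv, hexp, inv_one]
  have hun : ‖u‖ = r := by
    rw [hu, norm_mul, hexp, mul_one, Complex.norm_real, Real.norm_of_nonneg hr.le]
  have hvl : v / l = rdot := by rw [hv]; field_simp
  have hlr : l / r = r * θdot := by rw [hl_def]; field_simp
  have h1 : udot = ((v / l : ℝ) + Complex.I * ((l / r : ℝ) : ℂ)) *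
      Complex.exp (Complex.I * θ) := by
    rw [hvl, hlr, hudot]; push_cast; ring
  have hinv : Complex.exp (-(Complex.I * θ)) * Complex.exp (Complex.I * θ) = 1 := by
    rw [← Complex.exp_add, neg_add_cancel, Complex.exp_zero]
  have hrc : (r : ℂ) ≠ 0 := by exact_mod_cast hr0
  have hlc : (l : ℂ) ≠ 0 := by exact_mod_cast hl0
  have hr1 : (1 - r₁) / r₁ = l * (l / r) - 1 := by
    rw [hr₁]; field_simp
  have h2 : Complex.exp (-(Complex.I * θ)) * E =
      (((1 - r₁) / r₁ : ℝ) : ℂ) - Complex.I * (v : ℂ) := by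
    have hE2 : E = (((l * (l / r) - 1 : ℝ) : ℂ) - Complex.I * (v : ℂ)) *
        Complex.exp (Complex.I * θ) := by
      rw [hE, hun, hu, mul_div_right_comm, div_self hrc, h1]
      have hv2 : (v : ℂ) = l * ((v / l : ℝ) : ℂ) := by
        push_cast; field_simp
      rw [hv2, hvl]
      push_cast
      linear_combination (-(l : ℂ) * (l / r) * Complex.exp (Complex.I * θ)) * Complex.I_sq
    rw [hE2, hr1, mul_left_comm, hinv, mul_one]
  refine ⟨h1, h2, ?_⟩
  have hr1ne : r₁ ≠ 0 := by rw [hr₁]; positivity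
  have hn : ‖E‖ = ‖(((1 - r₁) / r₁ : ℝ) : ℂ) - Complex.I * (v : ℂ)‖ := by
    rw [← h2, norm_mul, hexp', one_mul]
  rw [hn, Complex.sq_norm, Complex.normSq_apply]
  simp only [Complex.sub_re, Complex.sub_im, Complex.mul_re, Complex.mul_im, Complex.I_re,
    Complex.I_im, Complex.ofReal_re, Complex.ofReal_im]
  field_simp
  ring
end

section
/- Let δ > 0 and suppose (r₁, v, x) : I → ℝ³ is differentiable on an interval I with r₁(t) ≠ 0 for all t, solving r₁' = v + 2δ·r₁·x, v' = −(r₁−1)/r₁³ − 2δ·v·x, x' = −3δ·x². Then the function H₁(t) := ½v(t)² + (r₁(t)−1)²/(2r₁(t)²) + 2δ·r₁(t)·v(t)·x(t) + 3δ²·r₁(t)²·x(t)² satisfies H₁'(t) = −6δ³·r₁(t)²·x(t)³ for all t ∈ I. -/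
/-- Along solutions of `r₁' = v + 2δr₁x`, `v' = -(r₁-1)/r₁³ - 2δvx`, `x' = -3δx²`,
the function `H₁ = ½v² + (r₁-1)²/(2r₁²) + 2δr₁vx + 3δ²r₁²x²` satisfies
`H₁' = -6δ³r₁²x³`. -/
theorem lie_derivative_H1
    (δ : ℝ) (hδ : 0 < δ) (I : Set ℝ) (r₁ v x : ℝ → ℝ)
    (hne : ∀ t ∈ I, r₁ t ≠ 0)
    (hr₁ : ∀ t ∈ I, HasDerivAt r₁ (v t + 2 * δ * r₁ t * x t) t)
    (hv : ∀ t ∈ I, HasDerivAt v (-(r₁ t - 1) / (r₁ t) ^ 3 - 2 * δ * v t * x t) t)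
    (hx : ∀ t ∈ I, HasDerivAt x (-3 * δ * (x t) ^ 2) t) :
    ∀ t ∈ I,
      HasDerivAt
        (fun s => (1 / 2) * (v s) ^ 2 + (r₁ s - 1) ^ 2 / (2 * (r₁ s) ^ 2) +
          2 * δ * r₁ s * v s * x s + 3 * δ ^ 2 * (r₁ s) ^ 2 * (x s) ^ 2)
        (-6 * δ ^ 3 * (r₁ t) ^ 2 * (x t) ^ 3) t := by
  intro t ht
  have h0 := hne t ht
  have hr := hr₁ t ht
  have hw := hv t ht
  have hy := hx t ht
  have h1 := (hw.fun_pow 2).const_mul (1 / 2 : ℝ)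
  have h2 := ((hr.sub_const 1).fun_pow 2).fun_div ((hr.fun_pow 2).const_mul (2 : ℝ))
    (mul_ne_zero two_ne_zero (pow_ne_zero 2 h0))
  have h3 := ((hr.const_mul (2 * δ)).fun_mul hw).fun_mul hy
  have h4 := ((hr.fun_pow 2).const_mul (3 * δ ^ 2)).fun_mul (hy.fun_pow 2)
  refine (((h1.fun_add h2).fun_add h3).fun_add h4).congr_deriv ?_
  field_simp
  norm_num
  ring
end

section
/- (Iterative averaging lemma.) Let n ≥ 1 be an integer, δ > 0, c > 0, xₙ > 0, and let Jₙ ⊂ ℝ be an open interval. Let Λₙ, Ωₙ be real-analytic on Jₙ × (−xₙ, xₙ) and Rₙ, Pₙ real-analytic on Jₙ × ℝ × (−xₙ, xₙ) and 2π-periodic in their second argument, with Ωₙ(H, 0) ≥ c for all H ∈ Jₙ. Then for every open interval Jₙ₊₁ whose closure is compact and contained in Jₙ, there exist xₙ₊₁ ∈ (0, xₙ], real-analytic functions Tₙ, Qₙ on Jₙ₊₁ × ℝ × (−xₙ₊₁, xₙ₊₁) that are 2π-periodic in the second argument, real-analytic functions Λₙ₊₁, Ωₙ₊₁ on Jₙ₊₁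 × (−xₙ₊₁, xₙ₊₁), and real-analytic functions Rₙ₊₁, Pₙ₊₁ on Jₙ₊₁ × ℝ × (−xₙ₊₁, xₙ₊₁) that are 2π-periodic in the second argument, such that the following holds: whenever (Hₙ, φₙ, x) : I → Jₙ₊₁ × ℝ × (0, xₙ₊₁) is a differentiable solution of Hₙ' = x³·Λₙ(Hₙ, x) + x^{n+2}·Rₙ(Hₙ, φₙ, x), φₙ' = Ωₙ(Hₙ, x) + xⁿ·Pₙ(Hₙ, φₙ, x), x' = −3δ·x², and the functions Hₙ₊₁ := Hₙ + x^{n+2}·Tₙ(Hₙ, φₙ, x) and φₙ₊₁ := φₙ + xⁿ·Qₙ(Hₙ, φₙ, x) satisfy Hₙ₊₁(t) ∈ Jₙ₊₁ for all t ∈ I, then Hₙ₊₁' = x³·Λₙ₊₁(Hₙ₊₁, x) + x^{n+3}·Rₙ₊₁(Hₙ₊₁, φₙ₊₁, x) and φₙ₊₁' = Ωₙ₊₁(Hₙ₊₁, x) + x^{n+1}·Qₙ₊₁-free form x^{n+1}·Pₙ₊₁(Hₙ₊₁, φₙ₊₁, x) hold on I. -/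
open Set Filter Topology MeasureTheory
open scoped Interval

attribute [local fun_prop] analyticAt_fst analyticAt_snd

theorem analyticAt_fderiv_apply {E : Type*} [NormedAddCommGroup E] [NormedSpace ℝ E]
    {f : E → ℝ} {z : E} (hf : AnalyticAt ℝ f z) (v : E) :
    AnalyticAt ℝ (fun q => fderiv ℝ f q v) z :=
  AnalyticAt.fun_comp (g := fun l : E →L[ℝ] ℝ => ContinuousLinearMap.apply ℝ ℝ v l)
    (ContinuousLinearMap.analyticAt _ _) hf.fderiv

/-- Averaging along `t ↦ (p, s₀ + t u)` preserves analyticity at `u = 0`. -/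
theorem analyticAt_integral_scale {E : Type*} [NormedAddCommGroup E] [NormedSpace ℝ E]
    (F : E × ℝ → ℝ) (p0 : E) (s0 : ℝ) (hF : AnalyticAt ℝ F (p0, s0)) :
    AnalyticAt ℝ (fun q : E × ℝ => ∫ t in (0:ℝ)..1, F (q.1, s0 + t * q.2)) (p0, 0) := by
  obtain ⟨p, r, hp⟩ := hF
  let L : ℝ → (E × ℝ →L[ℝ] E × ℝ) := fun t =>
    (ContinuousLinearMap.fst ℝ E ℝ).prod (t • ContinuousLinearMap.snd ℝ E ℝ)
  have hLapp : ∀ t y, L t y = (y.1, t * y.2) := fun t y => by simp [L]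
  have hLc : Continuous L := by
    have h1 : L = fun t => (ContinuousLinearMap.inl ℝ E ℝ).comp (ContinuousLinearMap.fst ℝ E ℝ)
        + t • (ContinuousLinearMap.inr ℝ E ℝ).comp (ContinuousLinearMap.snd ℝ E ℝ) := by
      ext t <;> simp [L]
    rw [h1]
    fun_prop
  have hLy : ∀ t ∈ Ι (0:ℝ) 1, ∀ y, ‖L t y‖ ≤ ‖y‖ := by
    intro t ht y
    rw [uIoc_of_le zero_le_one] at ht
    rw [hLapp, Prod.norm_def, Prod.norm_def]
    refine max_le_max le_rfl ?_
    simp only [norm_mul, Real.norm_eq_abs, abs_of_pos ht.1]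
    exact mul_le_of_le_one_left (abs_nonneg _) ht.2
  have hLn : ∀ t ∈ Ι (0:ℝ) 1, ‖L t‖ ≤ 1 := fun t ht =>
    ContinuousLinearMap.opNorm_le_bound _ zero_le_one fun y => by simpa using hLy t ht y
  let G : (n : ℕ) → ℝ → ContinuousMultilinearMap ℝ (fun _ : Fin n => E × ℝ) ℝ := fun n t =>
    (p n).compContinuousLinearMap (fun _ => L t)
  have hGc : ∀ n, Continuous (G n) := by
    intro n
    have : G n = fun t => ContinuousMultilinearMap.compContinuousLinearMapLRight (p n)
        (fun _ => L t) := by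
      ext t; simp [G]
    rw [this]
    exact (ContinuousMultilinearMap.cont _).comp (by fun_prop)
  have hGn : ∀ n, ∀ t ∈ Ι (0:ℝ) 1, ‖G n t‖ ≤ ‖p n‖ := by
    intro n t ht
    refine ((p n).norm_compContinuousLinearMap_le _).trans ?_
    refine mul_le_of_le_one_right (norm_nonneg _) ?_
    exact Finset.prod_le_one (fun _ _ => norm_nonneg _) (fun _ _ => hLn t ht)
  let q : FormalMultilinearSeries ℝ (E × ℝ) ℝ := fun n => ∫ t in (0:ℝ)..1, G n t
  have hqn : ∀ n, ‖q n‖ ≤ ‖p n‖ := by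
    intro n
    have := intervalIntegral.norm_integral_le_of_norm_le_const (a := (0:ℝ)) (b := 1) (hGn n)
    simpa using this
  refine ⟨q, r, ?_, hp.r_pos, ?_⟩
  · refine hp.r_le.trans ?_
    refine ENNReal.le_of_forall_nnreal_lt fun s hs => ?_
    refine q.le_radius_of_summable ?_
    exact Summable.of_nonneg_of_le (fun _ => by positivity)
      (fun n => mul_le_mul_of_nonneg_right (hqn n) (by positivity)) (p.summable_norm_mul_pow hs)
  · intro y hy
    have hq : ∀ n, q n (fun _ => y) = ∫ t in (0:ℝ)..1, p n (fun _ => L t y) := by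
      intro n
      simp only [q]
      rw [intervalIntegral.integral_of_le zero_le_one, intervalIntegral.integral_of_le zero_le_one,
        ContinuousMultilinearMap.integral_apply]
      · simp only [G, ContinuousMultilinearMap.compContinuousLinearMap_apply]
      · exact ((hGc n).intervalIntegrable 0 1).1
    simp only [hq]
    have hyr : (‖y‖₊ : ENNReal) < p.radius := by
      have : ‖y‖ₑ < r := by simpa using hy
      exact this.trans_le hp.r_le
    have hsum : Summable fun n : ℕ => ‖p n‖ * ‖y‖ ^ n := by
      have := p.summable_norm_mul_pow hyr
      simpa only [coe_nnnorm] using this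
    refine intervalIntegral.hasSum_integral_of_dominated_convergence
      (fun n _ => ‖p n‖ * ‖y‖ ^ n) ?_ ?_ ?_ ?_ ?_
    · intro n
      refine Continuous.aestronglyMeasurable ?_
      exact (p n).cont.comp (continuous_pi fun _ => by fun_prop)
    · intro n
      refine Eventually.of_forall fun t ht => ?_
      refine ((p n).le_opNorm _).trans ?_
      refine mul_le_mul_of_nonneg_left ?_ (norm_nonneg _)
      rw [Finset.prod_const, Finset.card_univ, Fintype.card_fin]
      exact pow_le_pow_left₀ (norm_nonneg _) (hLy t ht y) n
    · exact Eventually.of_forall fun t ht => hsum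
    · exact intervalIntegrable_const
    · refine Eventually.of_forall fun t ht => ?_
      have hm : L t y ∈ Metric.eball (0 : E × ℝ) r := by
        have h1 : ‖y‖ₑ < r := by simpa using hy
        have h2 : ‖L t y‖ₑ ≤ ‖y‖ₑ := by
          rw [enorm_le_iff_norm_le]; exact hLy t ht y
        simpa using h2.trans_lt h1
      have := hp.hasSum hm
      rw [hLapp] at this
      simpa [hLapp] using this

/-- Analyticity of divided differences in the last variable. -/
theorem analyticAt_dslope {E : Type*} [NormedAddCommGroup E] [NormedSpace ℝ E]
    (f : E × ℝ → ℝ) (p0 : E) (u0 : ℝ) (hf : AnalyticAt ℝ f (p0, u0))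
    (hf0 : AnalyticAt ℝ f (p0, 0)) :
    AnalyticAt ℝ (fun q : E × ℝ => dslope (fun u => f (q.1, u)) 0 q.2) (p0, u0) := by
  rcases eq_or_ne u0 0 with rfl | hu
  · have hd : AnalyticAt ℝ (fun q : E × ℝ => fderiv ℝ f q (0, 1)) (p0, 0) :=
      analyticAt_fderiv_apply hf _
    have hI := analyticAt_integral_scale _ p0 0 hd
    refine hI.congr ?_
    obtain ⟨ε, hε, hball⟩ := Metric.eventually_nhds_iff_ball.1 hf.eventually_analyticAt
    filter_upwards [Metric.ball_mem_nhds _ hε] with q hq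
    have hmem : ∀ t ∈ Icc (0:ℝ) 1, AnalyticAt ℝ f (q.1, t * q.2) := by
      intro t ht
      apply hball
      rw [Metric.mem_ball, Prod.dist_eq] at hq ⊢
      refine (max_le_max le_rfl ?_).trans_lt hq
      simp only [dist_zero_right, norm_mul, Real.norm_eq_abs, abs_of_nonneg ht.1]
      exact mul_le_of_le_one_left (abs_nonneg _) ht.2
    have hder : ∀ u, AnalyticAt ℝ f (q.1, u) →
        HasDerivAt (fun u => f (q.1, u)) (fderiv ℝ f (q.1, u) (0, 1)) u := by
      intro u hu
      have h1 : HasDerivAt (fun u : ℝ => (q.1, u)) ((0 : E), (1:ℝ)) u :=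
        (hasDerivAt_const u q.1).prodMk (hasDerivAt_id u)
      exact hu.differentiableAt.hasFDerivAt.comp_hasDerivAt u h1
    simp only [zero_add]
    rcases eq_or_ne q.2 0 with h0 | h0
    · have := hder 0 (by simpa using hmem 0 (by simp))
      simp [h0, this.deriv]
    · rw [dslope_of_ne _ h0, slope_def_field]
      have hcont : ContinuousOn (fun t : ℝ => fderiv ℝ f (q.1, t * q.2) (0, 1) * q.2)
          (uIcc 0 1) := by
        intro t ht
        rw [uIcc_of_le zero_le_one] at ht
        have h2 : ContinuousAt (fun z : E × ℝ => fderiv ℝ f z (0, 1)) (q.1, t * q.2) :=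
          (analyticAt_fderiv_apply (hmem t ht) _).continuousAt
        have h3 : ContinuousAt (fun t : ℝ => (q.1, t * q.2)) t := by fun_prop
        exact ((h2.comp (f := fun t : ℝ => (q.1, t * q.2)) h3).mul continuousAt_const).continuousWithinAt
      have := intervalIntegral.integral_eq_sub_of_hasDerivAt (a := (0:ℝ)) (b := 1)
        (f := fun t => f (q.1, t * q.2))
        (f' := fun t => fderiv ℝ f (q.1, t * q.2) (0, 1) * q.2) (by
          intro t ht
          rw [uIcc_of_le zero_le_one] at ht
          have h4 : HasDerivAt (fun t : ℝ => t * q.2) q.2 t := by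
            simpa using (hasDerivAt_id t).mul_const q.2
          exact (hder _ (hmem t ht)).comp t h4) hcont.intervalIntegrable
      rw [intervalIntegral.integral_mul_const] at this
      simp only [one_mul, zero_mul] at this
      rw [eq_div_iff (by simpa using h0)]
      simpa using this
  · have h1 : AnalyticAt ℝ (fun q : E × ℝ => (f q - f (q.1, 0)) / (q.2 - 0)) (p0, u0) := by
      refine AnalyticAt.div (hf.sub ?_) (by fun_prop) (by simpa using hu)
      exact AnalyticAt.fun_comp (f := fun q : E × ℝ => (q.1, (0:ℝ))) (by simpa using hf0) (by fun_prop)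
    refine h1.congr ?_
    have : ∀ᶠ q : E × ℝ in 𝓝 (p0, u0), q.2 ≠ 0 :=
      continuousAt_snd.eventually_ne hu
    filter_upwards [this] with q hq
    rw [dslope_of_ne _ hq, slope_def_field]

theorem analyticAt_primitive_local (F : ℝ × ℝ → ℝ) (p0 s0 : ℝ) (hF : AnalyticAt ℝ F (p0, s0)) :
    AnalyticAt ℝ (fun q : ℝ × ℝ => ∫ v in s0..q.2, F (q.1, v)) (p0, s0) := by
  have h1 := analyticAt_integral_scale F p0 s0 hF
  have h2 : AnalyticAt ℝ (fun q : ℝ × ℝ => ((q.1, q.2 - s0) : ℝ × ℝ)) (p0, s0) := by fun_prop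
  have h3 : AnalyticAt ℝ (fun q : ℝ × ℝ => ∫ t in (0:ℝ)..1, F (q.1, s0 + t * (q.2 - s0)))
      (p0, s0) :=
    AnalyticAt.fun_comp (f := fun q : ℝ × ℝ => ((q.1, q.2 - s0) : ℝ × ℝ)) (by simpa using h1) h2
  have h4 : AnalyticAt ℝ (fun q : ℝ × ℝ => q.2 - s0) (p0, s0) := by fun_prop
  refine (h4.mul h3).congr (Eventually.of_forall fun q => ?_)
  have := intervalIntegral.smul_integral_comp_add_mul (a := 0) (b := 1)
    (fun v => F (q.1, v)) (q.2 - s0) s0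
  simp only [smul_eq_mul, mul_zero, add_zero, mul_one, add_sub_cancel] at this
  simp only [Pi.mul_apply]
  rw [← this]
  simp only [mul_comm]

theorem analyticOnNhd_primitive (J : Set ℝ) (hJ : IsOpen J) (F : ℝ × ℝ → ℝ)
    (hF : AnalyticOnNhd ℝ F (J ×ˢ univ)) :
    AnalyticOnNhd ℝ (fun q : ℝ × ℝ => ∫ v in (0:ℝ)..q.2, F (q.1, v)) (J ×ˢ univ) := by
  have hcont : ∀ H ∈ J, Continuous fun v => F (H, v) := by
    intro H hH
    rw [continuous_iff_continuousAt]
    intro v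
    have h1 : ContinuousAt F (H, v) := (hF (H, v) ⟨hH, trivial⟩).continuousAt
    exact h1.comp (f := fun v : ℝ => (H, v)) (by fun_prop)
  have hadd : ∀ H ∈ J, ∀ s0 s : ℝ, ∫ v in (0:ℝ)..s, F (H, v) =
      (∫ v in (0:ℝ)..s0, F (H, v)) + ∫ v in s0..s, F (H, v) := by
    intro H hH s0 s
    exact (intervalIntegral.integral_add_adjacent_intervals
      ((hcont H hH).intervalIntegrable _ _) ((hcont H hH).intervalIntegrable _ _)).symm
  rintro ⟨H0, φ0⟩ ⟨hH0, -⟩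
  have hJn : J ∈ 𝓝 H0 := hJ.mem_nhds hH0
  have key : ∀ s0 : ℝ, ∀ᶠ s in 𝓝 s0, AnalyticAt ℝ (fun H => ∫ v in s0..s, F (H, v)) H0 := by
    intro s0
    have h1 := (analyticAt_primitive_local F H0 s0 (hF _ ⟨hH0, trivial⟩)).eventually_analyticAt
    have h2 : Tendsto (fun s : ℝ => (H0, s)) (𝓝 s0) (𝓝 (H0, s0)) :=
      ContinuousAt.tendsto (f := fun s : ℝ => (H0, s)) (by fun_prop)
    filter_upwards [h2.eventually h1] with s hs
    exact AnalyticAt.fun_comp (g := fun q : ℝ × ℝ => ∫ v in s0..q.2, F (q.1, v))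
      (f := fun H : ℝ => (H, s)) hs (by fun_prop)
  have hiff : ∀ s0 : ℝ, ∀ᶠ s in 𝓝 s0, (AnalyticAt ℝ (fun H => ∫ v in (0:ℝ)..s, F (H, v)) H0 ↔
      AnalyticAt ℝ (fun H => ∫ v in (0:ℝ)..s0, F (H, v)) H0) := by
    intro s0
    filter_upwards [key s0] with s hs
    constructor
    · intro h
      refine (h.sub hs).congr ?_
      filter_upwards [hJn] with H hH
      simp [hadd H hH s0 s]
    · intro h
      refine (h.add hs).congr ?_
      filter_upwards [hJn] with H hH
      simp [hadd H hH s0 s]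
  have hall : {s : ℝ | AnalyticAt ℝ (fun H => ∫ v in (0:ℝ)..s, F (H, v)) H0} = univ := by
    refine IsClopen.eq_univ ⟨⟨?_⟩, ?_⟩ ⟨0, ?_⟩
    · rw [isOpen_iff_eventually]
      intro s hs
      filter_upwards [hiff s] with s' h
      exact fun h' => hs (h.1 h')
    · rw [isOpen_iff_eventually]
      intro s hs
      filter_upwards [hiff s] with s' h
      exact h.2 hs
    · simpa using analyticAt_const
  have hφ : AnalyticAt ℝ (fun H => ∫ v in (0:ℝ)..φ0, F (H, v)) H0 := by
    have : φ0 ∈ {s : ℝ | AnalyticAt ℝ (fun H => ∫ v in (0:ℝ)..s, F (H, v)) H0} := by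
      rw [hall]; trivial
    exact this
  have h5 : AnalyticAt ℝ (fun q : ℝ × ℝ => ∫ v in (0:ℝ)..φ0, F (q.1, v)) (H0, φ0) :=
    AnalyticAt.fun_comp (g := fun H => ∫ v in (0:ℝ)..φ0, F (H, v)) (f := fun q : ℝ × ℝ => q.1)
      hφ (by fun_prop)
  refine (h5.add (analyticAt_primitive_local F H0 φ0 (hF _ ⟨hH0, trivial⟩))).congr ?_
  have : ∀ᶠ q : ℝ × ℝ in 𝓝 (H0, φ0), q.1 ∈ J := continuousAt_fst.eventually hJn
  filter_upwards [this] with q hq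
  simp [hadd q.1 hq φ0 q.2]

/-- Solution of the homological equation. -/
theorem homological (J : Set ℝ) (hJ : IsOpen J) (F : ℝ × ℝ → ℝ) (ω : ℝ → ℝ)
    (hF : AnalyticOnNhd ℝ F (J ×ˢ univ)) (hω : AnalyticOnNhd ℝ ω J) (hω0 : ∀ H ∈ J, ω H ≠ 0)
    (hper : ∀ H φ, F (H, φ + 2 * Real.pi) = F (H, φ)) :
    ∃ (T : ℝ × ℝ → ℝ) (m : ℝ → ℝ), AnalyticOnNhd ℝ T (J ×ˢ univ) ∧ AnalyticOnNhd ℝ m J ∧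
      (∀ H φ, T (H, φ + 2 * Real.pi) = T (H, φ)) ∧
      ∀ H ∈ J, ∀ φ, F (H, φ) + fderiv ℝ T (H, φ) (0, 1) * ω H = m H := by
  classical
  have hprim := analyticOnNhd_primitive J hJ F hF
  let m : ℝ → ℝ := fun H => (∫ v in (0:ℝ)..2 * Real.pi, F (H, v)) / (2 * Real.pi)
  let S : ℝ × ℝ → ℝ := fun q => (q.2 * m q.1 - ∫ v in (0:ℝ)..q.2, F (q.1, v)) / ω q.1
  let T : ℝ × ℝ → ℝ := fun q => if q.1 ∈ J then S q else 0
  have hm : AnalyticOnNhd ℝ m J := by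
    intro H hH
    have h1 := AnalyticAt.fun_comp (f := fun H : ℝ => (H, 2 * Real.pi)) (x := H)
      (hprim (H, 2 * Real.pi) ⟨hH, trivial⟩) (by fun_prop)
    exact h1.div analyticAt_const (by positivity)
  have hS : AnalyticOnNhd ℝ S (J ×ˢ univ) := by
    rintro ⟨H, φ⟩ ⟨hH, -⟩
    have h1 : AnalyticAt ℝ (fun q : ℝ × ℝ => m q.1) (H, φ) :=
      AnalyticAt.fun_comp (f := fun q : ℝ × ℝ => q.1) (hm H hH) (by fun_prop)
    have h2 : AnalyticAt ℝ (fun q : ℝ × ℝ => ω q.1) (H, φ) :=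
      AnalyticAt.fun_comp (f := fun q : ℝ × ℝ => q.1) (hω H hH) (by fun_prop)
    exact ((analyticAt_snd.mul h1).sub (hprim _ ⟨hH, trivial⟩)).div h2 (hω0 H hH)
  have hTS : ∀ q ∈ J ×ˢ (univ : Set ℝ), T =ᶠ[𝓝 q] S := by
    intro q hq
    filter_upwards [(hJ.prod isOpen_univ).mem_nhds hq] with q' hq'
    simp [T, hq'.1]
  have hcont : ∀ H ∈ J, Continuous fun v => F (H, v) := by
    intro H hH
    rw [continuous_iff_continuousAt]
    intro v
    have h1 : ContinuousAt F (H, v) := (hF (H, v) ⟨hH, trivial⟩).continuousAt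
    exact h1.comp (f := fun v : ℝ => (H, v)) (by fun_prop)
  refine ⟨T, m, ?_, hm, ?_, ?_⟩
  · intro q hq
    exact (hS q hq).congr (hTS q hq).symm
  · intro H φ
    by_cases hH : H ∈ J
    · simp only [T, hH, if_true, S]
      congr 1
      have h1 : Function.Periodic (fun v => F (H, v)) (2 * Real.pi) := fun v => hper H v
      have h2 := h1.intervalIntegral_add_eq φ 0
      have h3 := intervalIntegral.integral_add_adjacent_intervals
        ((hcont H hH).intervalIntegrable 0 φ)
        ((hcont H hH).intervalIntegrable (μ := volume) φ (φ + 2 * Real.pi))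
      rw [← h3, h2, zero_add]
      simp only [m]
      field_simp
      ring
    · simp [T, hH]
  · intro H hH φ
    have hq : (H, φ) ∈ J ×ˢ (univ : Set ℝ) := ⟨hH, trivial⟩
    rw [(hTS _ hq).fderiv_eq]
    have h1 : HasDerivAt (fun u : ℝ => (H, u)) ((0 : ℝ), (1:ℝ)) φ :=
      (hasDerivAt_const φ H).prodMk (hasDerivAt_id φ)
    have h2 := (hS _ hq).differentiableAt.hasFDerivAt.comp_hasDerivAt φ h1
    have h3 : HasDerivAt (fun u => ∫ v in (0:ℝ)..u, F (H, v)) (F (H, φ)) φ :=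
      intervalIntegral.integral_hasDerivAt_right ((hcont H hH).intervalIntegrable _ _)
        ((hcont H hH).stronglyMeasurableAtFilter _ _) (hcont H hH).continuousAt
    have h4 : HasDerivAt (fun u => (u * m H - ∫ v in (0:ℝ)..u, F (H, v)) / ω H)
        ((1 * m H - F (H, φ)) / ω H) φ := (((hasDerivAt_id φ).mul_const _).sub h3).div_const _
    have h5 := h2.unique h4
    rw [h5]
    have := hω0 H hH
    field_simp
    ring

/-- Uniform inversion of the near-identity map `z ↦ z + x V(z,x)`. -/
theorem near_identity_inverse (a b a' b' : ℝ) (ha : a < a') (hb : b' < b)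
    (V : (ℝ × ℝ) × ℝ → ℝ × ℝ)
    (hV : AnalyticOnNhd ℝ V ((Ioo a b ×ˢ univ) ×ˢ univ))
    (hper : ∀ H φ x, V ((H, φ + 2 * Real.pi), x) = V ((H, φ), x)) :
    ∃ x1 > 0, ∃ G : (ℝ × ℝ) × ℝ → ℝ × ℝ,
      AnalyticOnNhd ℝ G ((Ioo a' b' ×ˢ univ) ×ˢ Ioo (-x1) x1) ∧
      (∀ K ψ x, G ((K, ψ + 2 * Real.pi), x) = G ((K, ψ), x) + (0, 2 * Real.pi)) ∧
      (∀ K ∈ Ioo a' b', ∀ ψ, ∀ x ∈ Ioo (-x1) x1, (G ((K, ψ), x)).1 ∈ Ioo a b ∧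
        G ((K, ψ), x) + x • V (G ((K, ψ), x), x) = (K, ψ)) ∧
      (∀ z : ℝ × ℝ, ∀ x ∈ Ioo (-x1) x1, z.1 ∈ Ioo a' b' → G (z + x • V (z, x), x) = z) := by
  classical
  obtain ⟨a2, ha2, ha2'⟩ := exists_between ha
  obtain ⟨b2, hb2, hb2'⟩ := exists_between hb
  let s : Set (ℝ × ℝ) := Ioo a2 b2 ×ˢ univ
  have hso : IsOpen s := isOpen_Ioo.prod isOpen_univ
  have hsc : Convex ℝ s := (convex_Ioo _ _).prod convex_univ
  have hsJ : ∀ z ∈ s, ∀ x : ℝ, (z, x) ∈ (Ioo a b ×ˢ (univ : Set ℝ)) ×ˢ (univ : Set ℝ) := by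
    intro z hz x
    exact ⟨⟨⟨ha2.trans hz.1.1, hz.1.2.trans hb2'⟩, trivial⟩, trivial⟩
  -- uniform bounds
  have hbound : ∃ M > 0, ∀ z ∈ s, ∀ x ∈ Icc (-1:ℝ) 1,
      ‖V (z, x)‖ ≤ M ∧ ‖fderiv ℝ V (z, x)‖ ≤ M := by
    let C : Set ((ℝ × ℝ) × ℝ) := (Icc a2 b2 ×ˢ Icc 0 (2 * Real.pi)) ×ˢ Icc (-1) 1
    have hC : IsCompact C := (isCompact_Icc.prod isCompact_Icc).prod isCompact_Icc
    have hCJ : ∀ w ∈ C, AnalyticAt ℝ V w := by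
      intro w hw
      exact hV w ⟨⟨⟨ha2.trans_le hw.1.1.1, hw.1.1.2.trans_lt hb2'⟩, trivial⟩, trivial⟩
    obtain ⟨M1, hM1⟩ := hC.exists_bound_of_continuousOn
      (f := V) fun w hw => (hCJ w hw).continuousAt.continuousWithinAt
    obtain ⟨M2, hM2⟩ := hC.exists_bound_of_continuousOn
      (f := fderiv ℝ V) fun w hw => (hCJ w hw).fderiv.continuousAt.continuousWithinAt
    have hfper : ∀ H φ x, fderiv ℝ V ((H, φ + 2 * Real.pi), x) = fderiv ℝ V ((H, φ), x) := by
      intro H φ x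
      have h1 : (fun w : (ℝ × ℝ) × ℝ => V (w + ((0, 2 * Real.pi), 0))) = V := by
        funext ⟨⟨H, φ⟩, x⟩
        simpa using hper H φ x
      have h2 := fderiv_comp_add_right (𝕜 := ℝ) (f := V) (x := ((H, φ), x))
        ((0, 2 * Real.pi), 0)
      rw [h1] at h2
      rw [h2]
      simp
    refine ⟨max (max M1 M2) 1, by positivity, ?_⟩
    rintro ⟨H, φ⟩ hz x hx
    have hp : Function.Periodic (fun φ => (V ((H, φ), x), fderiv ℝ V ((H, φ), x)))
        (2 * Real.pi) := fun φ => by simp only [hper, hfper]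
    obtain ⟨φ', hφ', he⟩ := hp.exists_mem_Ico₀ (by positivity) φ
    simp only [Prod.mk.injEq] at he
    have hw : ((H, φ'), x) ∈ C := ⟨⟨Ioo_subset_Icc_self hz.1, Ico_subset_Icc_self hφ'⟩, hx⟩
    rw [he.1, he.2]
    exact ⟨(hM1 _ hw).trans ((le_max_left _ _).trans (le_max_left _ _)),
      (hM2 _ hw).trans ((le_max_right _ _).trans (le_max_left _ _))⟩
  obtain ⟨M, hM, hMb⟩ := hbound
  let ε : ℝ := min (a' - a2) (b2 - b')
  have hε : 0 < ε := lt_min (by linarith) (by linarith)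
  let x1 : ℝ := min 1 (min (1 / (2 * M)) (ε / (4 * M)))
  have hx1 : 0 < x1 := by positivity
  have hxle : ∀ x ∈ Ioo (-x1) x1, x ∈ Icc (-1:ℝ) 1 ∧ |x| * M ≤ 1 / 2 ∧ |x| * M ≤ ε / 4 := by
    intro x hx
    have h0 : |x| < x1 := abs_lt.2 hx
    have h1 : |x| ≤ 1 := h0.le.trans (min_le_left _ _)
    have h2 : |x| ≤ 1 / (2 * M) := h0.le.trans ((min_le_right _ _).trans (min_le_left _ _))
    have h3 : |x| ≤ ε / (4 * M) := h0.le.trans ((min_le_right _ _).trans (min_le_right _ _))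
    refine ⟨abs_le.1 h1, ?_, ?_⟩
    · rw [le_div_iff₀ (by positivity)] at h2
      linarith
    · rw [le_div_iff₀ (by positivity)] at h3
      linarith
  have hlip : ∀ x ∈ Ioo (-x1) x1, ∀ z ∈ s, ∀ z' ∈ s,
      ‖x • V (z, x) - x • V (z', x)‖ ≤ 1 / 2 * ‖z - z'‖ := by
    intro x hx z hz z' hz'
    obtain ⟨hx', hxM, -⟩ := hxle x hx
    have h1 : ‖V (z, x) - V (z', x)‖ ≤ M * ‖z - z'‖ := by
      refine hsc.norm_image_sub_le_of_norm_hasFDerivWithin_le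
        (f := fun z => V (z, x))
        (f' := fun z => (fderiv ℝ V (z, x)).comp (ContinuousLinearMap.inl ℝ (ℝ × ℝ) ℝ))
        ?_ ?_ hz' hz
      · intro w hw
        have h2 := (hV _ (hsJ w hw x)).differentiableAt.hasFDerivAt
        have h3 : HasFDerivAt (fun w : ℝ × ℝ => (w, x)) (ContinuousLinearMap.inl ℝ (ℝ × ℝ) ℝ) w :=
          hasFDerivAt_prodMk_left w x
        exact (h2.comp w h3).hasFDerivWithinAt
      · intro w hw
        refine ContinuousLinearMap.opNorm_le_bound _ hM.le fun v => ?_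
        refine ((fderiv ℝ V (w, x)).le_opNorm _).trans ?_
        have : ‖ContinuousLinearMap.inl ℝ (ℝ × ℝ) ℝ v‖ = ‖v‖ := by
          simp [Prod.norm_def]
        change _ * ‖ContinuousLinearMap.inl ℝ (ℝ × ℝ) ℝ v‖ ≤ _
        rw [this]
        exact mul_le_mul_of_nonneg_right (hMb w hw x hx').2 (norm_nonneg _)
    rw [← smul_sub, norm_smul, Real.norm_eq_abs]
    calc |x| * ‖V (z, x) - V (z', x)‖ ≤ |x| * (M * ‖z - z'‖) :=
          mul_le_mul_of_nonneg_left h1 (abs_nonneg _)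
      _ = |x| * M * ‖z - z'‖ := by ring
      _ ≤ _ := mul_le_mul_of_nonneg_right hxM (norm_nonneg _)
  have hinj : ∀ x ∈ Ioo (-x1) x1, ∀ z ∈ s, ∀ z' ∈ s,
      z + x • V (z, x) = z' + x • V (z', x) → z = z' := by
    intro x hx z hz z' hz' he
    have h1 := hlip x hx z' hz' z hz
    have h2 : x • V (z', x) - x • V (z, x) = z - z' := by
      rw [sub_eq_sub_iff_add_eq_add, add_comm, ← he]
    rw [h2, norm_sub_rev z' z] at h1
    have h3 : ‖z - z'‖ ≤ 0 := by linarith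
    exact sub_eq_zero.1 (norm_le_zero_iff.1 h3)
  have hsurj : ∀ x ∈ Ioo (-x1) x1, ∀ w : ℝ × ℝ, w.1 ∈ Ioo a' b' →
      ∃ z ∈ s, z + x • V (z, x) = w := by
    intro x hx w hw
    obtain ⟨hx', -, hxM⟩ := hxle x hx
    have happ : ApproximatesLinearOn (fun z => z + x • V (z, x))
        (ContinuousLinearMap.id ℝ (ℝ × ℝ)) s (1 / 2 : NNReal) := by
      intro z hz z' hz'
      have h1 := hlip x hx z hz z' hz'
      have h2 : z + x • V (z, x) - (z' + x • V (z', x)) -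
          (ContinuousLinearMap.id ℝ (ℝ × ℝ)) (z - z') = x • V (z, x) - x • V (z', x) := by
        simp only [ContinuousLinearMap.id_apply]
        abel
      rw [h2]
      simpa using h1
    let ri : (ContinuousLinearMap.id ℝ (ℝ × ℝ)).NonlinearRightInverse :=
      { toFun := id, nnnorm := 1, bound' := fun y => by simp, right_inv' := fun y => by simp }
    have hball : Metric.closedBall w (ε / 2) ⊆ s := by
      rintro z hz
      rw [Metric.mem_closedBall, Prod.dist_eq] at hz
      have h1 : |z.1 - w.1| ≤ ε / 2 := (le_max_left _ _).trans hz
      have h2 := abs_le.1 h1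
      have h3 : ε ≤ a' - a2 := min_le_left _ _
      have h4 : ε ≤ b2 - b' := min_le_right _ _
      have h5 := hw.1
      have h6 := hw.2
      exact ⟨⟨by linarith, by linarith⟩, trivial⟩
    have h7 := happ.surjOn_closedBall_of_nonlinearRightInverse ri (by positivity) hball
    have h8 : w ∈ Metric.closedBall ((fun z => z + x • V (z, x)) w)
        (((ri.nnnorm : ℝ)⁻¹ - ((1 / 2 : NNReal) : ℝ)) * (ε / 2)) := by
      rw [Metric.mem_closedBall, dist_eq_norm]
      have h9 : w - (w + x • V (w, x)) = -(x • V (w, x)) := by abel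
      simp only [h9, norm_neg, norm_smul, Real.norm_eq_abs]
      have h10 : |x| * ‖V (w, x)‖ ≤ |x| * M :=
        mul_le_mul_of_nonneg_left (hMb w (hball (Metric.mem_closedBall_self (by positivity))) x hx').1
          (abs_nonneg _)
      have h11 : (((ri.nnnorm : ℝ)⁻¹ - ((1 / 2 : NNReal) : ℝ)) * (ε / 2)) = ε / 4 := by
        simp only [ri]
        push_cast
        ring
      rw [h11]
      exact h10.trans hxM
    obtain ⟨z, hz, he⟩ := h7 h8
    exact ⟨z, hball hz, he⟩
  let P : (ℝ × ℝ) × ℝ → Prop := fun w => w.2 ∈ Ioo (-x1) x1 ∧ ∃ z ∈ s, z + w.2 • V (z, w.2) = w.1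
  let G : (ℝ × ℝ) × ℝ → ℝ × ℝ := fun w => if h : P w then h.2.choose else w.1
  have hG : ∀ w, P w → G w ∈ s ∧ G w + w.2 • V (G w, w.2) = w.1 := by
    intro w h
    simp only [G, h, dif_pos]
    exact h.2.choose_spec
  have hGu : ∀ x ∈ Ioo (-x1) x1, ∀ z ∈ s, G (z + x • V (z, x), x) = z := by
    intro x hx z hz
    have h1 := hG (z + x • V (z, x), x) ⟨hx, z, hz, rfl⟩
    exact hinj x hx _ h1.1 z hz h1.2
  have hss : ∀ z : ℝ × ℝ, z.1 ∈ Ioo a' b' → z ∈ s := fun z hz =>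
    ⟨⟨ha2'.trans hz.1, hz.2.trans hb2⟩, trivial⟩
  have hshift : ∀ z : ℝ × ℝ, ∀ x, V (z + (0, 2 * Real.pi), x) = V (z, x) := by
    rintro ⟨H, φ⟩ x
    simpa using hper H φ x
  have hshift' : ∀ z : ℝ × ℝ, ∀ x, V (z - (0, 2 * Real.pi), x) = V (z, x) := by
    intro z x
    have := hshift (z - (0, 2 * Real.pi)) x
    rw [sub_add_cancel] at this
    exact this.symm
  refine ⟨x1, hx1, G, ?_, ?_, ?_, ?_⟩
  · rintro ⟨w0, x0⟩ ⟨⟨hw0, -⟩, hx0⟩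
    have hP0 : P (w0, x0) := ⟨hx0, hsurj x0 hx0 w0 hw0⟩
    obtain ⟨hz0, hz0e⟩ := hG _ hP0
    set z0 := G (w0, x0) with hz0def
    simp only at hz0e
    let Φ : (ℝ × ℝ) × ℝ → (ℝ × ℝ) × ℝ := fun q => (q.1 + q.2 • V q, q.2)
    have hVa : AnalyticAt ℝ V (z0, x0) := hV _ (hsJ _ hz0 _)
    have hΦ : AnalyticAt ℝ Φ (z0, x0) := by
      refine AnalyticAt.prod ?_ analyticAt_snd
      exact analyticAt_fst.add (analyticAt_snd.smul hVa)
    let D : (ℝ × ℝ) × ℝ →L[ℝ] (ℝ × ℝ) × ℝ := fderiv ℝ Φ (z0, x0)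
    have hD : ∀ v, D v = (v.1 + (x0 • fderiv ℝ V (z0, x0) v + v.2 • V (z0, x0)), v.2) := by
      intro v
      have h1 : HasFDerivAt Φ _ (z0, x0) :=
        (hasFDerivAt_fst.add (hasFDerivAt_snd.smul hVa.differentiableAt.hasFDerivAt)).prodMk
          hasFDerivAt_snd
      simp only [D]
      rw [h1.fderiv]
      simp
    have hDinj : Function.Injective D := by
      rw [injective_iff_map_eq_zero]
      intro v hv
      rw [hD] at hv
      have hv2 : v.2 = 0 := congrArg Prod.snd hv
      have hv1 : v.1 + (x0 • fderiv ℝ V (z0, x0) v + v.2 • V (z0, x0)) = 0 :=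
        congrArg Prod.fst hv
      rw [hv2, zero_smul, add_zero] at hv1
      have hn : ‖v‖ = ‖v.1‖ := by simp [Prod.norm_def v, hv2]
      obtain ⟨hx', hxM, -⟩ := hxle x0 hx0
      have h3 : ‖v.1‖ ≤ 1 / 2 * ‖v.1‖ := by
        calc ‖v.1‖ = ‖x0 • fderiv ℝ V (z0, x0) v‖ := by
              rw [eq_neg_of_add_eq_zero_left hv1, norm_neg]
          _ ≤ |x0| * (M * ‖v.1‖) := by
              rw [norm_smul, Real.norm_eq_abs]
              refine mul_le_mul_of_nonneg_left ?_ (abs_nonneg _)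
              refine ((fderiv ℝ V (z0, x0)).le_opNorm v).trans ?_
              rw [hn]
              exact mul_le_mul_of_nonneg_right (hMb z0 hz0 x0 hx').2 (norm_nonneg _)
          _ = |x0| * M * ‖v.1‖ := by ring
          _ ≤ _ := mul_le_mul_of_nonneg_right hxM (norm_nonneg _)
      have h4 : v.1 = 0 := norm_le_zero_iff.1 (by linarith [norm_nonneg v.1])
      exact Prod.ext h4 hv2
    let i : ((ℝ × ℝ) × ℝ) ≃L[ℝ] (ℝ × ℝ) × ℝ :=
      (LinearEquiv.ofInjectiveEndo (D : (ℝ × ℝ) × ℝ →ₗ[ℝ] (ℝ × ℝ) × ℝ) hDinj).toContinuousLinearEquiv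
    have hi : D = (i : (ℝ × ℝ) × ℝ →L[ℝ] (ℝ × ℝ) × ℝ) := by
      refine ContinuousLinearMap.ext fun v => ?_
      rfl
    have hstrict : HasStrictFDerivAt Φ (i : (ℝ × ℝ) × ℝ →L[ℝ] (ℝ × ℝ) × ℝ) (z0, x0) := by
      rw [← hi]
      exact hΦ.hasStrictFDerivAt
    let e := hstrict.toOpenPartialHomeomorph Φ
    have hmem : (z0, x0) ∈ e.source := hstrict.mem_toOpenPartialHomeomorph_source
    have hΦ0 : Φ (z0, x0) = (w0, x0) := Prod.ext hz0e rfl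
    have hesymm : AnalyticAt ℝ e.symm (w0, x0) := by
      rw [← hΦ0]
      exact e.analyticAt_symm' (i := i) hmem hΦ hi
    have he0 : e.symm (w0, x0) = (z0, x0) := by
      rw [← hΦ0]
      exact e.left_inv hmem
    have htgt : (w0, x0) ∈ e.target := by
      rw [← hΦ0]
      exact e.map_source hmem
    have hfin : AnalyticAt ℝ (fun w => (e.symm w).1) (w0, x0) :=
      AnalyticAt.fun_comp (g := Prod.fst) analyticAt_fst hesymm
    refine hfin.congr ?_
    have hev : ∀ᶠ w in 𝓝 (w0, x0), e.symm w ∈ s ×ˢ Ioo (-x1) x1 := by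
      refine hesymm.continuousAt.eventually_mem ?_
      rw [he0]
      exact (hso.prod isOpen_Ioo).mem_nhds ⟨hz0, hx0⟩
    filter_upwards [hev, e.open_target.mem_nhds htgt] with w hw hwt
    have h1 : Φ (e.symm w) = w := e.right_inv hwt
    have h2 := hGu (e.symm w).2 hw.2 (e.symm w).1 hw.1
    have h3 : ((e.symm w).1 + (e.symm w).2 • V ((e.symm w).1, (e.symm w).2), (e.symm w).2) = w := h1
    rw [h3] at h2
    exact h2.symm
  · intro K ψ x
    by_cases h : P ((K, ψ), x)
    · obtain ⟨h1, h2⟩ := hG _ h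
      have h3 := hGu x h.1 (G ((K, ψ), x) + (0, 2 * Real.pi)) ⟨by simpa using h1.1, trivial⟩
      rw [hshift, add_right_comm, h2] at h3
      simpa using h3
    · have h' : ¬ P ((K, ψ + 2 * Real.pi), x) := by
        rintro ⟨hx, z, hz, he⟩
        refine h ⟨hx, z - (0, 2 * Real.pi), ⟨by simpa using hz.1, trivial⟩, ?_⟩
        simp only at he ⊢
        rw [hshift', sub_add_eq_add_sub, he]
        simp
      simp [G, h, h']
  · intro K hK ψ x hx
    obtain ⟨h1, h2⟩ := hG ((K, ψ), x) ⟨hx, hsurj x hx (K, ψ) hK⟩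
    exact ⟨⟨ha2.trans h1.1.1, h1.1.2.trans hb2'⟩, h2⟩
  · intro z x hx hz
    exact hGu x hx z (hss z hz)

theorem hasDerivAt_comp_pair (U : ℝ × ℝ → ℝ) (f g : ℝ → ℝ) (f' g' t : ℝ)
    (hU : AnalyticAt ℝ U (f t, g t)) (hf : HasDerivAt f f' t) (hg : HasDerivAt g g' t) :
    HasDerivAt (fun s => U (f s, g s))
      (f' * fderiv ℝ U (f t, g t) (1, 0) + g' * fderiv ℝ U (f t, g t) (0, 1)) t := by
  have h := hU.differentiableAt.hasFDerivAt.comp_hasDerivAt t (hf.prodMk hg)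
  have h1 : ((f', g') : ℝ × ℝ) = f' • ((1, 0) : ℝ × ℝ) + g' • ((0, 1) : ℝ × ℝ) := by simp
  rw [h1, map_add, map_smul, map_smul] at h
  exact h

/-- The Iterative (averaging) Lemma: one step of the normal-form procedure for
`Hₙ' = x³Λₙ(Hₙ,x) + x^{n+2}Rₙ(Hₙ,φₙ,x)`, `φₙ' = Ωₙ(Hₙ,x) + xⁿPₙ(Hₙ,φₙ,x)`,
`x' = -3δx²`: a near-identity change of variables
`Hₙ₊₁ = Hₙ + x^{n+2}Tₙ(Hₙ,φₙ,x)`, `φₙ₊₁ = φₙ + xⁿQₙ(Hₙ,φₙ,x)` pushes the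
angle-dependence of the `H`-equation one order higher in `x`. -/
theorem iterative_averaging_lemma
    (n : ℕ) (hn : 1 ≤ n) (δ c xn : ℝ) (hδ : 0 < δ) (hc : 0 < c) (hxn : 0 < xn)
    (a b : ℝ)
    (Λn Ωn : ℝ × ℝ → ℝ) (Rn Pn : ℝ × ℝ × ℝ → ℝ)
    (hΛn : AnalyticOnNhd ℝ Λn (Set.Ioo a b ×ˢ Set.Ioo (-xn) xn))
    (hΩn : AnalyticOnNhd ℝ Ωn (Set.Ioo a b ×ˢ Set.Ioo (-xn) xn))
    (hRn : AnalyticOnNhd ℝ Rn (Set.Ioo a b ×ˢ (Set.univ : Set ℝ) ×ˢ Set.Ioo (-xn) xn))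
    (hPn : AnalyticOnNhd ℝ Pn (Set.Ioo a b ×ˢ (Set.univ : Set ℝ) ×ˢ Set.Ioo (-xn) xn))
    (hRper : ∀ H φ x : ℝ, Rn (H, φ + 2 * Real.pi, x) = Rn (H, φ, x))
    (hPper : ∀ H φ x : ℝ, Pn (H, φ + 2 * Real.pi, x) = Pn (H, φ, x))
    (hΩc : ∀ H ∈ Set.Ioo a b, c ≤ Ωn (H, 0)) :
    ∀ a' b' : ℝ, Set.Icc a' b' ⊆ Set.Ioo a b →
    ∃ xn1 ∈ Set.Ioc (0 : ℝ) xn,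
    ∃ (Tn Qn : ℝ × ℝ × ℝ → ℝ) (Λn1 Ωn1 : ℝ × ℝ → ℝ) (Rn1 Pn1 : ℝ × ℝ × ℝ → ℝ),
      AnalyticOnNhd ℝ Tn (Set.Ioo a' b' ×ˢ (Set.univ : Set ℝ) ×ˢ Set.Ioo (-xn1) xn1) ∧
      AnalyticOnNhd ℝ Qn (Set.Ioo a' b' ×ˢ (Set.univ : Set ℝ) ×ˢ Set.Ioo (-xn1) xn1) ∧
      AnalyticOnNhd ℝ Λn1 (Set.Ioo a' b' ×ˢ Set.Ioo (-xn1) xn1) ∧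
      AnalyticOnNhd ℝ Ωn1 (Set.Ioo a' b' ×ˢ Set.Ioo (-xn1) xn1) ∧
      AnalyticOnNhd ℝ Rn1 (Set.Ioo a' b' ×ˢ (Set.univ : Set ℝ) ×ˢ Set.Ioo (-xn1) xn1) ∧
      AnalyticOnNhd ℝ Pn1 (Set.Ioo a' b' ×ˢ (Set.univ : Set ℝ) ×ˢ Set.Ioo (-xn1) xn1) ∧
      (∀ H φ x : ℝ, Tn (H, φ + 2 * Real.pi, x) = Tn (H, φ, x)) ∧
      (∀ H φ x : ℝ, Qn (H, φ + 2 * Real.pi, x) = Qn (H, φ, x)) ∧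
      (∀ H φ x : ℝ, Rn1 (H, φ + 2 * Real.pi, x) = Rn1 (H, φ, x)) ∧
      (∀ H φ x : ℝ, Pn1 (H, φ + 2 * Real.pi, x) = Pn1 (H, φ, x)) ∧
      (∀ (I : Set ℝ) (Hf φf xf : ℝ → ℝ),
        (∀ t ∈ I, Hf t ∈ Set.Ioo a' b') →
        (∀ t ∈ I, xf t ∈ Set.Ioo (0 : ℝ) xn1) →
        (∀ t ∈ I, HasDerivAt Hf
          ((xf t) ^ 3 * Λn (Hf t, xf t) + (xf t) ^ (n + 2) * Rn (Hf t, φf t, xf t)) t) →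
        (∀ t ∈ I, HasDerivAt φf
          (Ωn (Hf t, xf t) + (xf t) ^ n * Pn (Hf t, φf t, xf t)) t) →
        (∀ t ∈ I, HasDerivAt xf (-3 * δ * (xf t) ^ 2) t) →
        (∀ t ∈ I, Hf t + (xf t) ^ (n + 2) * Tn (Hf t, φf t, xf t) ∈ Set.Ioo a' b') →
        ∀ t ∈ I,
          HasDerivAt (fun s => Hf s + (xf s) ^ (n + 2) * Tn (Hf s, φf s, xf s))
            ((xf t) ^ 3 *
                Λn1 (Hf t + (xf t) ^ (n + 2) * Tn (Hf t, φf t, xf t), xf t) +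
              (xf t) ^ (n + 3) *
                Rn1 (Hf t + (xf t) ^ (n + 2) * Tn (Hf t, φf t, xf t),
                  φf t + (xf t) ^ n * Qn (Hf t, φf t, xf t), xf t)) t ∧
          HasDerivAt (fun s => φf s + (xf s) ^ n * Qn (Hf s, φf s, xf s))
            (Ωn1 (Hf t + (xf t) ^ (n + 2) * Tn (Hf t, φf t, xf t), xf t) +
              (xf t) ^ (n + 1) *
                Pn1 (Hf t + (xf t) ^ (n + 2) * Tn (Hf t, φf t, xf t),
                  φf t + (xf t) ^ n * Qn (Hf t, φf t, xf t), xf t)) t) := by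
  classical
  intro a' b' hsub
  rcases le_or_gt b' a' with hba | hab
  · have hE : Set.Ioo a' b' = ∅ := Set.Ioo_eq_empty (not_lt.2 hba)
    refine ⟨xn, ⟨hxn, le_rfl⟩, 0, 0, 0, 0, 0, 0, ?_⟩
    simp only [hE, Set.empty_prod]
    refine ⟨fun _ h => h.elim, fun _ h => h.elim, fun _ h => h.elim, fun _ h => h.elim,
      fun _ h => h.elim, fun _ h => h.elim, fun _ _ _ => rfl, fun _ _ _ => rfl,
      fun _ _ _ => rfl, fun _ _ _ => rfl, ?_⟩
    intro I Hf φf xf h1 _ _ _ _ _ t ht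
    exact (h1 t ht).elim
  obtain ⟨m, rfl⟩ : ∃ m, n = m + 1 := ⟨n - 1, by omega⟩
  have ha : a < a' := (hsub ⟨le_rfl, hab.le⟩).1
  have hb : b' < b := (hsub ⟨hab.le, le_rfl⟩).2
  have hx0 : (0:ℝ) ∈ Set.Ioo (-xn) xn := ⟨by linarith, hxn⟩
  have hω : AnalyticOnNhd ℝ (fun H => Ωn (H, 0)) (Set.Ioo a b) := by
    intro H hH
    exact AnalyticAt.fun_comp (f := fun H : ℝ => (H, (0:ℝ))) (hΩn (H, 0) ⟨hH, hx0⟩) (by fun_prop)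
  have hω0 : ∀ H ∈ Set.Ioo a b, Ωn (H, 0) ≠ 0 := fun H hH => (hc.trans_le (hΩc H hH)).ne'
  have hslice : ∀ F : ℝ × ℝ × ℝ → ℝ,
      AnalyticOnNhd ℝ F (Set.Ioo a b ×ˢ (Set.univ : Set ℝ) ×ˢ Set.Ioo (-xn) xn) →
      AnalyticOnNhd ℝ (fun z : ℝ × ℝ => F (z.1, z.2, 0)) (Set.Ioo a b ×ˢ Set.univ) := by
    rintro F hF z ⟨hz, -⟩
    exact AnalyticAt.fun_comp (f := fun z : ℝ × ℝ => (z.1, z.2, (0:ℝ)))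
      (hF (z.1, z.2, 0) ⟨hz, trivial, hx0⟩) (by fun_prop)
  obtain ⟨T, mR, hT, hmR, hTper, hTeq⟩ := homological (Set.Ioo a b) isOpen_Ioo
    (fun z => Rn (z.1, z.2, 0)) (fun H => Ωn (H, 0)) (hslice Rn hRn) hω hω0
    (fun H φ => hRper H φ 0)
  obtain ⟨Q, mP, hQ, hmP, hQper, hQeq⟩ := homological (Set.Ioo a b) isOpen_Ioo
    (fun z => Pn (z.1, z.2, 0)) (fun H => Ωn (H, 0)) (hslice Pn hPn) hω hω0
    (fun H φ => hPper H φ 0)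
  let V : (ℝ × ℝ) × ℝ → ℝ × ℝ := fun q => (q.2 ^ (m + 2) * T q.1, q.2 ^ m * Q q.1)
  have hV : AnalyticOnNhd ℝ V ((Set.Ioo a b ×ˢ Set.univ) ×ˢ Set.univ) := by
    rintro ⟨z, x⟩ ⟨hz, -⟩
    have h1 : AnalyticAt ℝ (fun q : (ℝ × ℝ) × ℝ => T q.1) (z, x) :=
      AnalyticAt.fun_comp (f := fun q : (ℝ × ℝ) × ℝ => q.1) (hT z hz) (by fun_prop)
    have h2 : AnalyticAt ℝ (fun q : (ℝ × ℝ) × ℝ => Q q.1) (z, x) :=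
      AnalyticAt.fun_comp (f := fun q : (ℝ × ℝ) × ℝ => q.1) (hQ z hz) (by fun_prop)
    exact ((analyticAt_snd.pow _).mul h1).prod ((analyticAt_snd.pow _).mul h2)
  have hxV : ∀ z x, z + x • V (z, x) =
      (z.1 + x ^ (m + 1 + 2) * T z, z.2 + x ^ (m + 1) * Q z) := by
    intro z x
    refine Prod.ext ?_ ?_
    · simp [V]; ring
    · simp [V]; ring
  obtain ⟨x1, hx1, G, hG, hGper, hGeq, hGinv⟩ := near_identity_inverse a b a' b' ha hb V hV
    (fun H φ x => by simp only [V, hTper, hQper])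
  simp only [hxV] at hGeq hGinv
  have hsubJ : ∀ K ∈ Set.Ioo a' b', K ∈ Set.Ioo a b := fun K hK =>
    ⟨ha.trans hK.1, hK.2.trans hb⟩
  have hx1n : 0 < min x1 xn := lt_min hx1 hxn
  have hxa : ∀ x ∈ Set.Ioo (-(min x1 xn)) (min x1 xn), x ∈ Set.Ioo (-x1) x1 := by
    intro x hx
    have := min_le_left x1 xn
    exact ⟨by linarith [hx.1], by linarith [hx.2]⟩
  have hxb : ∀ x ∈ Set.Ioo (-(min x1 xn)) (min x1 xn), x ∈ Set.Ioo (-xn) xn := by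
    intro x hx
    have := min_le_right x1 xn
    exact ⟨by linarith [hx.1], by linarith [hx.2]⟩
  have hG3 : ∀ w ∈ Set.Ioo a' b' ×ˢ (Set.univ : Set ℝ) ×ˢ Set.Ioo (-(min x1 xn)) (min x1 xn),
      AnalyticAt ℝ (fun w : ℝ × ℝ × ℝ => G ((w.1, w.2.1), w.2.2)) w := by
    rintro ⟨K, ψ, x⟩ ⟨hK, -, hx⟩
    exact AnalyticAt.fun_comp (f := fun w : ℝ × ℝ × ℝ => ((w.1, w.2.1), w.2.2))
      (hG ((K, ψ), x) ⟨⟨hK, trivial⟩, hxa x hx⟩) (by fun_prop)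
  -- divided differences in `H`
  have hdiff : ∀ S : ℝ × ℝ → ℝ, AnalyticOnNhd ℝ S (Set.Ioo a b ×ˢ Set.Ioo (-xn) xn) →
      ∃ D : ℝ × ℝ × ℝ → ℝ, AnalyticOnNhd ℝ D
        (Set.Ioo a' b' ×ˢ (Set.univ : Set ℝ) ×ˢ Set.Ioo (-(min x1 xn)) (min x1 xn)) ∧
      (∀ H φ x : ℝ, D (H, φ + 2 * Real.pi, x) = D (H, φ, x)) ∧
      ∀ H ∈ Set.Ioo a' b', ∀ φ, ∀ x ∈ Set.Ioo (-(min x1 xn)) (min x1 xn),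
        x ^ (m + 1 + 2) * D (H + x ^ (m + 1 + 2) * T (H, φ), φ + x ^ (m + 1) * Q (H, φ), x) =
          S (H, x) - S (H + x ^ (m + 1 + 2) * T (H, φ), x) := by
    intro S hS
    refine ⟨fun w => dslope (fun y => S (w.1 + y * (-T (G ((w.1, w.2.1), w.2.2))), w.2.2)) 0
      (w.2.2 ^ (m + 1 + 2)), ?_, ?_, ?_⟩
    · rintro ⟨K, ψ, x⟩ ⟨hK, -, hx⟩
      obtain ⟨hGJ, hGe⟩ := hGeq K hK ψ x (hxa x hx)
      have hGe1 := congrArg Prod.fst hGe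
      simp only at hGe1
      let f : (ℝ × ℝ × ℝ) × ℝ → ℝ := fun q => S (q.1.1 + q.2 * q.1.2.1, q.1.2.2)
      have hfa : ∀ k τ y, k + y * τ ∈ Set.Ioo a b → AnalyticAt ℝ f ((k, τ, x), y) := by
        intro k τ y hk
        exact AnalyticAt.fun_comp
          (f := fun q : (ℝ × ℝ × ℝ) × ℝ => (q.1.1 + q.2 * q.1.2.1, q.1.2.2))
          (hS (k + y * τ, x) ⟨hk, hxb x hx⟩) (by fun_prop)
      have h1 := analyticAt_dslope f (K, -T (G ((K, ψ), x)), x) (x ^ (m + 1 + 2))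
        (hfa _ _ _ (by
          have : K + x ^ (m + 1 + 2) * (-T (G ((K, ψ), x))) = (G ((K, ψ), x)).1 := by
            linarith
          rw [this]; exact hGJ))
        (hfa _ _ _ (by simpa using hsubJ K hK))
      have h2 : AnalyticAt ℝ (fun w : ℝ × ℝ × ℝ => T (G ((w.1, w.2.1), w.2.2))) (K, ψ, x) :=
        AnalyticAt.fun_comp (g := T) (hT _ ⟨hGJ, trivial⟩) (hG3 (K, ψ, x) ⟨hK, trivial, hx⟩)
      have hw22 : AnalyticAt ℝ (fun w : ℝ × ℝ × ℝ => w.2.2) (K, ψ, x) := by fun_prop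
      exact AnalyticAt.fun_comp
        (g := fun q : (ℝ × ℝ × ℝ) × ℝ => dslope (fun u => f (q.1, u)) 0 q.2)
        (f := fun w : ℝ × ℝ × ℝ => ((w.1, -T (G ((w.1, w.2.1), w.2.2)), w.2.2),
          w.2.2 ^ (m + 1 + 2))) h1
        ((analyticAt_fst.prod (h2.fun_neg.prod hw22)).prod (hw22.fun_pow _))
    · intro K ψ x
      have h1 : T (G ((K, ψ + 2 * Real.pi), x)) = T (G ((K, ψ), x)) := by
        rw [hGper]
        generalize G ((K, ψ), x) = z
        obtain ⟨H, φ⟩ := z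
        simpa using hTper H φ
      simp only [h1]
    · intro H hH φ x hx
      have h1 := hGinv (H, φ) x (hxa x hx) hH
      simp only at h1 ⊢
      rw [h1]
      have h2 := sub_smul_dslope (fun y => S (H + x ^ (m + 1 + 2) * T (H, φ) + y * (-T (H, φ)), x))
        0 (x ^ (m + 1 + 2))
      rw [sub_zero, smul_eq_mul] at h2
      rw [h2]
      congr 3 <;> ring
  -- the terms of higher order
  have hbr : ∀ (F : ℝ × ℝ × ℝ → ℝ) (U : ℝ × ℝ → ℝ) (C : ℝ),
      AnalyticOnNhd ℝ F (Set.Ioo a b ×ˢ (Set.univ : Set ℝ) ×ˢ Set.Ioo (-xn) xn) →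
      (∀ H φ x : ℝ, F (H, φ + 2 * Real.pi, x) = F (H, φ, x)) →
      AnalyticOnNhd ℝ U (Set.Ioo a b ×ˢ Set.univ) →
      (∀ H φ : ℝ, U (H, φ + 2 * Real.pi) = U (H, φ)) →
      ∃ A : ℝ × ℝ × ℝ → ℝ, AnalyticOnNhd ℝ A
        (Set.Ioo a' b' ×ˢ (Set.univ : Set ℝ) ×ˢ Set.Ioo (-(min x1 xn)) (min x1 xn)) ∧
      (∀ H φ x : ℝ, A (H, φ + 2 * Real.pi, x) = A (H, φ, x)) ∧
      ∀ H ∈ Set.Ioo a' b', ∀ φ, ∀ x ∈ Set.Ioo (-(min x1 xn)) (min x1 xn),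
        x * A (H + x ^ (m + 1 + 2) * T (H, φ), φ + x ^ (m + 1) * Q (H, φ), x) =
          (F (H, φ, x) - F (H, φ, 0)) +
          fderiv ℝ U (H, φ) (0, 1) * (Ωn (H, x) - Ωn (H, 0)) +
          x ^ (m + 1) * (fderiv ℝ U (H, φ) (0, 1) * Pn (H, φ, x)) +
          fderiv ℝ U (H, φ) (1, 0) * (x ^ 3 * Λn (H, x) + x ^ (m + 1 + 2) * Rn (H, φ, x)) -
          C * x * U (H, φ) := by
    intro F U C hF hFper hU hUper
    let B : (ℝ × ℝ) × ℝ → ℝ := fun q =>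
          (F (q.1.1, q.1.2, q.2) - F (q.1.1, q.1.2, 0)) +
          fderiv ℝ U q.1 (0, 1) * (Ωn (q.1.1, q.2) - Ωn (q.1.1, 0)) +
          q.2 ^ (m + 1) * (fderiv ℝ U q.1 (0, 1) * Pn (q.1.1, q.1.2, q.2)) +
          fderiv ℝ U q.1 (1, 0) *
            (q.2 ^ 3 * Λn (q.1.1, q.2) + q.2 ^ (m + 1 + 2) * Rn (q.1.1, q.1.2, q.2)) -
          C * q.2 * U q.1
    have hB : ∀ z : ℝ × ℝ, z.1 ∈ Set.Ioo a b → ∀ x ∈ Set.Ioo (-xn) xn, AnalyticAt ℝ B (z, x) := by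
      intro z hz x hx
      have e3 : ∀ F : ℝ × ℝ × ℝ → ℝ,
          AnalyticOnNhd ℝ F (Set.Ioo a b ×ˢ (Set.univ : Set ℝ) ×ˢ Set.Ioo (-xn) xn) →
          AnalyticAt ℝ (fun q : (ℝ × ℝ) × ℝ => F (q.1.1, q.1.2, q.2)) (z, x) := fun F hF =>
        AnalyticAt.fun_comp (f := fun q : (ℝ × ℝ) × ℝ => (q.1.1, q.1.2, q.2))
          (hF (z.1, z.2, x) ⟨hz, trivial, hx⟩) (by fun_prop)
      have e30 : AnalyticAt ℝ (fun q : (ℝ × ℝ) × ℝ => F (q.1.1, q.1.2, 0)) (z, x) :=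
        AnalyticAt.fun_comp (f := fun q : (ℝ × ℝ) × ℝ => (q.1.1, q.1.2, (0:ℝ)))
          (hF (z.1, z.2, 0) ⟨hz, trivial, hx0⟩) (by fun_prop)
      have e2 : ∀ F : ℝ × ℝ → ℝ,
          AnalyticOnNhd ℝ F (Set.Ioo a b ×ˢ Set.Ioo (-xn) xn) →
          AnalyticAt ℝ (fun q : (ℝ × ℝ) × ℝ => F (q.1.1, q.2)) (z, x) := fun F hF =>
        AnalyticAt.fun_comp (f := fun q : (ℝ × ℝ) × ℝ => (q.1.1, q.2))
          (hF (z.1, x) ⟨hz, hx⟩) (by fun_prop)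
      have e20 : AnalyticAt ℝ (fun q : (ℝ × ℝ) × ℝ => Ωn (q.1.1, 0)) (z, x) :=
        AnalyticAt.fun_comp (f := fun q : (ℝ × ℝ) × ℝ => (q.1.1, (0:ℝ)))
          (hΩn (z.1, 0) ⟨hz, hx0⟩) (by fun_prop)
      have eU : AnalyticAt ℝ (fun q : (ℝ × ℝ) × ℝ => U q.1) (z, x) :=
        AnalyticAt.fun_comp (f := fun q : (ℝ × ℝ) × ℝ => q.1) (hU z ⟨hz, trivial⟩) (by fun_prop)
      have eUd : ∀ v, AnalyticAt ℝ (fun q : (ℝ × ℝ) × ℝ => fderiv ℝ U q.1 v) (z, x) := fun v =>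
        AnalyticAt.fun_comp (g := fun z => fderiv ℝ U z v) (f := fun q : (ℝ × ℝ) × ℝ => q.1)
          (analyticAt_fderiv_apply (hU z ⟨hz, trivial⟩) v) (by fun_prop)
      have eF := e3 F hF
      have eR := e3 Rn hRn
      have eP := e3 Pn hPn
      have eΛ := e2 Λn hΛn
      have eΩ := e2 Ωn hΩn
      have eU1 := eUd (1, 0)
      have eU2 := eUd (0, 1)
      have e0 : AnalyticAt ℝ (fun q : (ℝ × ℝ) × ℝ => q.2) (z, x) := analyticAt_snd
      exact (((((eF.sub e30).add (eU2.mul (eΩ.sub e20))).add ((e0.pow _).mul (eU2.mul eP))).add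
        (eU1.mul (((e0.pow _).mul eΛ).add ((e0.pow _).mul eR))))).sub
        ((analyticAt_const.mul e0).mul eU)
    have hUd : ∀ z : ℝ × ℝ, fderiv ℝ U (z + (0, 2 * Real.pi)) = fderiv ℝ U z := by
      intro z
      have h1 : (fun w : ℝ × ℝ => U (w + (0, 2 * Real.pi))) = U := by
        funext ⟨H, φ⟩
        simpa using hUper H φ
      have h2 := fderiv_comp_add_right (𝕜 := ℝ) (f := U) (x := z) (0, 2 * Real.pi)
      rw [h1] at h2
      exact h2.symm
    have hBper : ∀ (z : ℝ × ℝ) (u : ℝ), B (z + (0, 2 * Real.pi), u) = B (z, u) := by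
      rintro ⟨H, φ⟩ u
      have h1 := hUd (H, φ)
      simp only [Prod.mk_add_mk, add_zero] at h1
      simp only [B, Prod.mk_add_mk, add_zero, h1, hFper, hPper, hRper, hUper]
    refine ⟨fun w => dslope (fun u => B (G ((w.1, w.2.1), w.2.2), u)) 0 w.2.2, ?_, ?_, ?_⟩
    · rintro ⟨K, ψ, x⟩ ⟨hK, -, hx⟩
      obtain ⟨hGJ, hGe⟩ := hGeq K hK ψ x (hxa x hx)
      have h1 := analyticAt_dslope B (G ((K, ψ), x)) x (hB _ hGJ x (hxb x hx)) (hB _ hGJ 0 hx0)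
      have h2 := hG3 (K, ψ, x) ⟨hK, trivial, hx⟩
      exact AnalyticAt.fun_comp
        (g := fun q : (ℝ × ℝ) × ℝ => dslope (fun u => B (q.1, u)) 0 q.2)
        (f := fun w : ℝ × ℝ × ℝ => (G ((w.1, w.2.1), w.2.2), w.2.2)) h1
        (h2.prod (by fun_prop))
    · intro K ψ x
      simp only [hGper, hBper]
    · intro H hH φ x hx
      have h1 := hGinv (H, φ) x (hxa x hx) hH
      simp only at h1 ⊢
      rw [h1]
      have h2 := sub_smul_dslope (fun u => B ((H, φ), u)) 0 x
      rw [sub_zero, smul_eq_mul] at h2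
      rw [h2]
      simp [B]
  let Λ1 : ℝ × ℝ → ℝ := fun q => Λn q + q.2 ^ m * mR q.1
  let Ω1 : ℝ × ℝ → ℝ := fun q => Ωn q + q.2 ^ (m + 1) * mP q.1
  have hΛ1 : AnalyticOnNhd ℝ Λ1 (Set.Ioo a b ×ˢ Set.Ioo (-xn) xn) := by
    intro q hq
    have h1 := hΛn q hq
    have h2 : AnalyticAt ℝ (fun q : ℝ × ℝ => mR q.1) q :=
      AnalyticAt.fun_comp (f := fun q : ℝ × ℝ => q.1) (hmR q.1 hq.1) (by fun_prop)
    exact h1.add ((analyticAt_snd.pow _).mul h2)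
  have hΩ1 : AnalyticOnNhd ℝ Ω1 (Set.Ioo a b ×ˢ Set.Ioo (-xn) xn) := by
    intro q hq
    have h1 := hΩn q hq
    have h2 : AnalyticAt ℝ (fun q : ℝ × ℝ => mP q.1) q :=
      AnalyticAt.fun_comp (f := fun q : ℝ × ℝ => q.1) (hmP q.1 hq.1) (by fun_prop)
    exact h1.add ((analyticAt_snd.pow _).mul h2)
  obtain ⟨D1, hD1, hD1per, hD1eq⟩ := hdiff Λ1 hΛ1
  obtain ⟨D2, hD2, hD2per, hD2eq⟩ := hdiff Ω1 hΩ1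
  obtain ⟨A1, hA1, hA1per, hA1eq⟩ := hbr Rn T (3 * δ * (m + 3)) hRn hRper hT hTper
  obtain ⟨A2, hA2, hA2per, hA2eq⟩ := hbr Pn Q (3 * δ * (m + 1)) hPn hPper hQ hQper
  have hdomsub : Set.Ioo a' b' ×ˢ Set.Ioo (-(min x1 xn)) (min x1 xn) ⊆
      Set.Ioo a b ×ˢ Set.Ioo (-xn) xn := fun q hq => ⟨hsubJ _ hq.1, hxb _ hq.2⟩
  have hlift : ∀ U : ℝ × ℝ → ℝ, AnalyticOnNhd ℝ U (Set.Ioo a b ×ˢ Set.univ) →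
      AnalyticOnNhd ℝ (fun q : ℝ × ℝ × ℝ => U (q.1, q.2.1))
        (Set.Ioo a' b' ×ˢ (Set.univ : Set ℝ) ×ˢ Set.Ioo (-(min x1 xn)) (min x1 xn)) := by
    intro U hU q hq
    exact AnalyticAt.fun_comp (f := fun q : ℝ × ℝ × ℝ => (q.1, q.2.1))
      (hU (q.1, q.2.1) ⟨hsubJ _ hq.1, trivial⟩) (by fun_prop)
  refine ⟨min x1 xn, ⟨hx1n, min_le_right _ _⟩, fun q => T (q.1, q.2.1), fun q => Q (q.1, q.2.1),
    Λ1, Ω1, fun q => q.2.2 ^ 2 * D1 q + A1 q, fun q => q.2.2 * D2 q + A2 q,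
    hlift T hT, hlift Q hQ, hΛ1.mono hdomsub, hΩ1.mono hdomsub, ?_, ?_,
    fun H φ _ => hTper H φ, fun H φ _ => hQper H φ,
    fun H φ x => by simp only [hD1per, hA1per], fun H φ x => by simp only [hD2per, hA2per], ?_⟩
  · intro q hq
    have h1 := hD1 q hq
    have h2 := hA1 q hq
    fun_prop
  · intro q hq
    have h1 := hD2 q hq
    have h2 := hA2 q hq
    fun_prop
  intro I Hf φf xf hH hx hdH hdφ hdx hK t ht
  have hxt : xf t ∈ Set.Ioo (-(min x1 xn)) (min x1 xn) :=
    ⟨by linarith [(hx t ht).1], (hx t ht).2⟩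
  have hHJ := hsubJ _ (hH t ht)
  have e1 := hD1eq (Hf t) (hH t ht) (φf t) (xf t) hxt
  have e2 := hD2eq (Hf t) (hH t ht) (φf t) (xf t) hxt
  have e3 := hA1eq (Hf t) (hH t ht) (φf t) (xf t) hxt
  have e4 := hA2eq (Hf t) (hH t ht) (φf t) (xf t) hxt
  have e5 := hTeq (Hf t) hHJ (φf t)
  have e6 := hQeq (Hf t) hHJ (φf t)
  have dT := hasDerivAt_comp_pair T Hf φf _ _ t (hT _ ⟨hHJ, trivial⟩) (hdH t ht) (hdφ t ht)
  have dQ := hasDerivAt_comp_pair Q Hf φf _ _ t (hQ _ ⟨hHJ, trivial⟩) (hdH t ht) (hdφ t ht)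
  have d1 := (hdH t ht).add (((hdx t ht).pow (m + 1 + 2)).mul dT)
  have d2 := (hdφ t ht).add (((hdx t ht).pow (m + 1)).mul dQ)
  have hl1 : Λ1 (Hf t, xf t) = Λn (Hf t, xf t) + xf t ^ m * mR (Hf t) := rfl
  have hl2 : Ω1 (Hf t, xf t) = Ωn (Hf t, xf t) + xf t ^ (m + 1) * mP (Hf t) := rfl
  rw [hl1] at e1
  rw [hl2] at e2
  simp only at e5 e6
  constructor
  · refine d1.congr_deriv ?_
    simp only [Pi.pow_apply, show m + 1 + 2 - 1 = m + 2 by omega]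
    push_cast
    linear_combination (-(xf t) ^ 3) * e1 - (xf t) ^ (m + 3) * e3 + (xf t) ^ (m + 3) * e5
  · refine d2.congr_deriv ?_
    simp only [Nat.add_sub_cancel, Pi.pow_apply]
    push_cast
    linear_combination (-1) * e2 - (xf t) ^ (m + 1) * e4 + (xf t) ^ (m + 1) * e6
end

section
/- Let δ > 0 and N ∈ ℕ. Let J ⊂ ℝ be a bounded open interval, J' a compact subset of J, and ξ₀ > 0. Suppose Λ, Ω : ℝ² → ℝ and R, P : ℝ³ → ℝ are C¹ on an open set containing cl(J) × [−ξ₀, ξ₀] (respectively cl(J) × ℝ × [−ξ₀, ξ₀]), bounded together with their first-order partial derivatives, and that R and P are 2π-periodic in their second argument. Then there exist ξ ∈ (0, ξ₀] and C > 0 such that for every (H₀, φ₀, x₀) ∈ J' × ℝ × (0, ξ) there exist differentiable functions H, φ : [0, x₀) → ℝ with H(0) = H₀, φ(0) = φ₀, H(τ) ∈ J for all τ, satisfying for all τ ∈ (0, x₀): H'(τ) = (1/(3δ))·(x₀−τ)·( Λ(H(τ), x₀−τ) + (x₀−τ)^N·R(H(τ), φ(τ), x₀−τ) ) and φ'(τ)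 = (1/(3δ·(x₀−τ)²))·( Ω(H(τ), x₀−τ) + (x₀−τ)^{N+1}·P(H(τ), φ(τ), x₀−τ) ); moreover |H(τ) − H₀| ≤ C·τ and |φ(τ) − φ₀|·(x₀ − τ) ≤ C for all τ ∈ [0, x₀). -/
open Set in
theorem aux_global_ode {E : Type*} [NormedAddCommGroup E] [NormedSpace ℝ E] [CompleteSpace E]
    (f : ℝ → E → E) (b : ℝ) (hb : 0 < b) (y₀ : E)
    (hcont : ∀ y, ContinuousOn (fun t => f t y) (Ico 0 b))
    (hbd : ∀ T ∈ Ioo 0 b, ∃ L : NNReal, ∀ t ∈ Icc 0 T,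
      (∀ y, ‖f t y‖ ≤ L) ∧ LipschitzWith L (f t)) :
    ∃ α : ℝ → E, α 0 = y₀ ∧ ∀ t ∈ Ico 0 b, HasDerivWithinAt α (f t (α t)) (Ici 0) t := by
  have key : ∀ T : ℝ, ∃ α : ℝ → E, T ∈ Ioo 0 b → α 0 = y₀ ∧
      ∀ t ∈ Icc 0 T, HasDerivWithinAt α (f t (α t)) (Icc 0 T) t := by
    intro T
    by_cases hT : T ∈ Ioo 0 b
    swap
    · exact ⟨fun _ => y₀, fun h => absurd h hT⟩
    obtain ⟨L, hL⟩ := hbd T hT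
    have hT0 : (0 : ℝ) ≤ T := hT.1.le
    have hpl : IsPicardLindelof f (tmin := 0) (tmax := T) ⟨0, le_rfl, hT0⟩ y₀
        (L * ⟨T, hT0⟩) 0 L L := by
      refine ⟨fun t ht => (hL t ht).2.lipschitzOnWith, fun y _ => (hcont y).mono ?_,
        fun t ht y _ => (hL t ht).1 y, ?_⟩
      · intro t ht
        exact ⟨ht.1, ht.2.trans_lt hT.2⟩
      · simp [hT0]
        exact le_rfl
    obtain ⟨α, h1, h2⟩ := hpl.exists_eq_forall_mem_Icc_hasDerivWithinAt₀
    exact ⟨α, fun _ => ⟨h1, h2⟩⟩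
  choose A hA using key
  have right : ∀ T ∈ Ioo 0 b, ∀ T' ≤ T, ∀ t ∈ Ico 0 T',
      HasDerivWithinAt (A T) (f t (A T t)) (Ici t) t := by
    intro T hT T' hT' t ht
    have h := (hA T hT).2 t ⟨ht.1, (ht.2.trans_le hT').le⟩
    have h2 : HasDerivWithinAt (A T) (f t (A T t)) (Icc t T) t :=
      h.mono (Icc_subset_Icc_left ht.1)
    exact h2.mono_of_mem_nhdsWithin (Icc_mem_nhdsGE (ht.2.trans_le hT'))
  have uniq : ∀ T ∈ Ioo 0 b, ∀ T' ∈ Ioo 0 b, T' ≤ T → ∀ t ∈ Icc 0 T', A T t = A T' t := by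
    intro T hT T' hT' hle
    obtain ⟨L, hL⟩ := hbd T hT
    refine ODE_solution_unique_of_mem_Icc_right (v := f) (s := fun _ => univ) (K := L)
      ?_ ?_ (right T hT T' hle) (fun _ _ => mem_univ _) ?_ (right T' hT' T' le_rfl)
      (fun _ _ => mem_univ _) ?_
    · intro t ht
      exact (hL t ⟨ht.1, ht.2.le.trans hle⟩).2.lipschitzOnWith
    · intro t ht
      exact (((hA T hT).2 t ⟨ht.1, ht.2.trans hle⟩).continuousWithinAt).mono
        (Icc_subset_Icc_right hle)
    · intro t ht
      exact ((hA T' hT').2 t ht).continuousWithinAt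
    · rw [(hA T hT).1, (hA T' hT').1]
  have hm : ∀ t ∈ Ico 0 b, (t + b) / 2 ∈ Ioo 0 b := by
    intro t ht
    have := ht.1
    have := ht.2
    constructor <;> linarith
  have eqA : ∀ T ∈ Ioo 0 b, ∀ t ∈ Icc 0 T, A ((t + b) / 2) t = A T t := by
    intro T hT t ht
    have ht' : t ∈ Ico 0 b := ⟨ht.1, ht.2.trans_lt hT.2⟩
    have h3 : t ∈ Icc 0 ((t + b) / 2) := ⟨ht.1, by linarith [ht'.2]⟩
    rcases le_total T ((t + b) / 2) with h | h
    · exact uniq _ (hm t ht') _ hT h t ht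
    · exact (uniq _ hT _ (hm t ht') h t h3).symm
  refine ⟨fun t => A ((t + b) / 2) t, ?_, ?_⟩
  · exact (hA _ (hm 0 ⟨le_rfl, hb⟩)).1
  · intro t ht
    have hT := hm t ht
    set T := (t + b) / 2 with hTdef
    have htT : t < T := by linarith [ht.2]
    have h := (hA T hT).2 t ⟨ht.1, htT.le⟩
    have h2 : HasDerivWithinAt (A T) (f t (A T t)) (Ici 0) t := by
      refine h.mono_of_mem_nhdsWithin ?_
      rw [← Ici_inter_Iic]
      exact Filter.inter_mem self_mem_nhdsWithin (mem_nhdsWithin_of_mem_nhds (Iic_mem_nhds htT))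
    have hev : (fun t => A ((t + b) / 2) t) =ᶠ[nhdsWithin t (Ici 0)] A T := by
      filter_upwards [self_mem_nhdsWithin, mem_nhdsWithin_of_mem_nhds (Iic_mem_nhds htT)]
        with s hs hs'
      exact eqA T hT s ⟨hs, hs'⟩
    exact h2.congr_of_eventuallyEq hev rfl

open Set in
theorem aux_rhs (M ξ₀ x₀ : ℝ) (n : ℕ) (hx₀ : x₀ ∈ Ioo 0 ξ₀) (hx1 : x₀ ≤ 1)
    (S : Set ℝ) (hS : Convex ℝ S)
    (F : ℝ × ℝ → ℝ) (G : ℝ × ℝ × ℝ → ℝ)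
    (U : Set (ℝ × ℝ)) (hUopen : IsOpen U) (hUsub : S ×ˢ Icc (-ξ₀) ξ₀ ⊆ U)
    (V : Set (ℝ × ℝ × ℝ)) (hVopen : IsOpen V)
    (hVsub : S ×ˢ (univ : Set ℝ) ×ˢ Icc (-ξ₀) ξ₀ ⊆ V)
    (hF : ContDiffOn ℝ 1 F U) (hG : ContDiffOn ℝ 1 G V)
    (hKF : ∀ p ∈ U, |F p| ≤ M ∧ ‖fderiv ℝ F p‖ ≤ M)
    (hKG : ∀ p ∈ V, |G p| ≤ M ∧ ‖fderiv ℝ G p‖ ≤ M)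
    (hM : 0 ≤ M)
    (p : ℝ → ℝ) (hp : ∀ h, p h ∈ S) (hp1 : ∀ h k, |p h - p k| ≤ |h - k|) :
    (∀ t ∈ Ico 0 x₀, ∀ y : ℝ × ℝ,
      |F (p y.1, x₀ - t) + (x₀ - t) ^ n * G (p y.1, y.2, x₀ - t)| ≤ 2 * M) ∧
    (∀ t ∈ Ico 0 x₀, ∀ y z : ℝ × ℝ,
      |(F (p y.1, x₀ - t) + (x₀ - t) ^ n * G (p y.1, y.2, x₀ - t)) -
        (F (p z.1, x₀ - t) + (x₀ - t) ^ n * G (p z.1, z.2, x₀ - t))| ≤ 2 * M * ‖y - z‖) ∧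
    (∀ y : ℝ × ℝ, ContinuousOn
      (fun t => F (p y.1, x₀ - t) + (x₀ - t) ^ n * G (p y.1, y.2, x₀ - t)) (Ico 0 x₀)) := by
  have hx : ∀ t ∈ Ico 0 x₀, x₀ - t ∈ Icc (-ξ₀) ξ₀ := by
    rintro t ⟨h1, h2⟩
    constructor <;> linarith [hx₀.1, hx₀.2]
  have hpow : ∀ t ∈ Ico 0 x₀, 0 ≤ (x₀ - t) ^ n ∧ (x₀ - t) ^ n ≤ 1 := by
    rintro t ⟨h1, h2⟩
    exact ⟨pow_nonneg (by linarith) _, pow_le_one₀ (by linarith) (by linarith)⟩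
  have mU : ∀ t ∈ Ico 0 x₀, ∀ h, (p h, x₀ - t) ∈ S ×ˢ Icc (-ξ₀) ξ₀ :=
    fun t ht h => ⟨hp h, hx t ht⟩
  have mV : ∀ t ∈ Ico 0 x₀, ∀ h φ,
      (p h, φ, x₀ - t) ∈ S ×ˢ (univ : Set ℝ) ×ˢ Icc (-ξ₀) ξ₀ :=
    fun t ht h φ => ⟨hp h, mem_univ _, hx t ht⟩
  have dF : ∀ q ∈ S ×ˢ Icc (-ξ₀) ξ₀, DifferentiableAt ℝ F q := fun q hq =>
    (hF.contDiffAt (hUopen.mem_nhds (hUsub hq))).differentiableAt one_ne_zero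
  have dG : ∀ q ∈ S ×ˢ (univ : Set ℝ) ×ˢ Icc (-ξ₀) ξ₀, DifferentiableAt ℝ G q := fun q hq =>
    (hG.contDiffAt (hVopen.mem_nhds (hVsub hq))).differentiableAt one_ne_zero
  have cU : Convex ℝ (S ×ˢ Icc (-ξ₀) ξ₀) := hS.prod (convex_Icc _ _)
  have cV : Convex ℝ (S ×ˢ (univ : Set ℝ) ×ˢ Icc (-ξ₀) ξ₀) :=
    hS.prod (convex_univ.prod (convex_Icc _ _))
  refine ⟨?_, ?_, ?_⟩
  · intro t ht y
    have h1 := (hKF _ (hUsub (mU t ht y.1))).1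
    have h2 := (hKG _ (hVsub (mV t ht y.1 y.2))).1
    obtain ⟨h3, h4⟩ := hpow t ht
    calc _ ≤ |F (p y.1, x₀ - t)| + |(x₀ - t) ^ n * G (p y.1, y.2, x₀ - t)| := abs_add_le _ _
      _ ≤ M + 1 * M := by
        rw [abs_mul, abs_of_nonneg h3]
        gcongr
      _ = 2 * M := by ring
  · intro t ht y z
    have hy1 : |p y.1 - p z.1| ≤ ‖y - z‖ := (hp1 _ _).trans (norm_fst_le (y - z))
    have hy2 : |y.2 - z.2| ≤ ‖y - z‖ := norm_snd_le (y - z)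
    have h1 : |F (p y.1, x₀ - t) - F (p z.1, x₀ - t)| ≤ M * ‖y - z‖ := by
      refine (cU.norm_image_sub_le_of_norm_fderiv_le dF (fun q hq => (hKF q (hUsub hq)).2)
        (mU t ht z.1) (mU t ht y.1)).trans ?_
      refine mul_le_mul_of_nonneg_left ?_ hM
      simp [Prod.norm_def, -Prod.fst_sub] at hy1 ⊢
      simpa using hy1
    have h2 : |G (p y.1, y.2, x₀ - t) - G (p z.1, z.2, x₀ - t)| ≤ M * ‖y - z‖ := by
      refine (cV.norm_image_sub_le_of_norm_fderiv_le dG (fun q hq => (hKG q (hVsub hq)).2)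
        (mV t ht z.1 z.2) (mV t ht y.1 y.2)).trans ?_
      refine mul_le_mul_of_nonneg_left ?_ hM
      rw [Prod.mk_sub_mk, Prod.mk_sub_mk, sub_self, Prod.norm_mk, Prod.norm_mk, norm_zero]
      exact max_le hy1 (max_le hy2 (norm_nonneg _))
    obtain ⟨h3, h4⟩ := hpow t ht
    calc _ = |(F (p y.1, x₀ - t) - F (p z.1, x₀ - t)) +
          (x₀ - t) ^ n * (G (p y.1, y.2, x₀ - t) - G (p z.1, z.2, x₀ - t))| := by
          congr 1; ring
      _ ≤ |F (p y.1, x₀ - t) - F (p z.1, x₀ - t)| +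
          |(x₀ - t) ^ n * (G (p y.1, y.2, x₀ - t) - G (p z.1, z.2, x₀ - t))| := abs_add_le _ _
      _ ≤ M * ‖y - z‖ + 1 * (M * ‖y - z‖) := by
        rw [abs_mul, abs_of_nonneg h3]
        gcongr
      _ = 2 * M * ‖y - z‖ := by ring
  · intro y t ht
    refine ContinuousAt.continuousWithinAt ?_
    have c1 : ContinuousAt (fun t => F (p y.1, x₀ - t)) t :=
      ContinuousAt.comp (g := F) (f := fun t => (p y.1, x₀ - t)) (dF _ (mU t ht y.1)).continuousAt
        (by fun_prop)
    have c2 : ContinuousAt (fun t => G (p y.1, y.2, x₀ - t)) t :=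
      ContinuousAt.comp (g := G) (f := fun t => (p y.1, y.2, x₀ - t))
        (dG _ (mV t ht y.1 y.2)).continuousAt (by fun_prop)
    exact c1.add (ContinuousAt.mul (by fun_prop) c2)


/-- Solutions of the normal-form system `dH/dτ = (1/(3δ))x(Λ + x^N R)`,
`dφ/dτ = (1/(3δx²))(Ω + x^{N+1}P)`, `x(τ) = x₀ - τ`, exist on the whole interval
`[0, x₀)` with uniform bounds `|H(τ) - H₀| ≤ Cτ` and `|φ(τ) - φ₀|·(x₀ - τ) ≤ C`. -/
theorem normal_form_flow_exists
    (δ : ℝ) (hδ : 0 < δ) (N : ℕ)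
    (J : Set ℝ) (hJopen : IsOpen J) (hJconv : Convex ℝ J)
    (hJbdd : Bornology.IsBounded J)
    (J' : Set ℝ) (hJ'cpt : IsCompact J') (hJ'sub : J' ⊆ J)
    (ξ₀ : ℝ) (hξ₀ : 0 < ξ₀)
    (Λ Ω : ℝ × ℝ → ℝ) (R P : ℝ × ℝ × ℝ → ℝ)
    (U : Set (ℝ × ℝ)) (hUopen : IsOpen U)
    (hUsub : closure J ×ˢ Set.Icc (-ξ₀) ξ₀ ⊆ U)
    (V : Set (ℝ × ℝ × ℝ)) (hVopen : IsOpen V)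
    (hVsub : closure J ×ˢ (Set.univ : Set ℝ) ×ˢ Set.Icc (-ξ₀) ξ₀ ⊆ V)
    (hΛ : ContDiffOn ℝ 1 Λ U) (hΩ : ContDiffOn ℝ 1 Ω U)
    (hR : ContDiffOn ℝ 1 R V) (hP : ContDiffOn ℝ 1 P V)
    (K : ℝ)
    (hKΛ : ∀ p ∈ U, |Λ p| ≤ K ∧ ‖fderiv ℝ Λ p‖ ≤ K)
    (hKΩ : ∀ p ∈ U, |Ω p| ≤ K ∧ ‖fderiv ℝ Ω p‖ ≤ K)
    (hKR : ∀ p ∈ V, |R p| ≤ K ∧ ‖fderiv ℝ R p‖ ≤ K)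
    (hKP : ∀ p ∈ V, |P p| ≤ K ∧ ‖fderiv ℝ P p‖ ≤ K)
    (hRper : ∀ H φ x : ℝ, R (H, φ + 2 * Real.pi, x) = R (H, φ, x))
    (hPper : ∀ H φ x : ℝ, P (H, φ + 2 * Real.pi, x) = P (H, φ, x)) :
    ∃ ξ ∈ Set.Ioc (0 : ℝ) ξ₀, ∃ C > (0 : ℝ),
      ∀ H₀ φ₀ x₀ : ℝ, H₀ ∈ J' → x₀ ∈ Set.Ioo (0 : ℝ) ξ →
        ∃ H φ : ℝ → ℝ,
          H 0 = H₀ ∧ φ 0 = φ₀ ∧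
          ContinuousOn H (Set.Ico 0 x₀) ∧ ContinuousOn φ (Set.Ico 0 x₀) ∧
          (∀ τ ∈ Set.Ico (0 : ℝ) x₀, H τ ∈ J) ∧
          (∀ τ ∈ Set.Ioo (0 : ℝ) x₀,
            HasDerivAt H
              ((1 / (3 * δ)) * ((x₀ - τ) *
                (Λ (H τ, x₀ - τ) + (x₀ - τ) ^ N * R (H τ, φ τ, x₀ - τ)))) τ ∧
            HasDerivAt φ
              ((1 / (3 * δ * (x₀ - τ) ^ 2)) *
                (Ω (H τ, x₀ - τ) + (x₀ - τ) ^ (N + 1) * P (H τ, φ τ, x₀ - τ))) τ) ∧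
          (∀ τ ∈ Set.Ico (0 : ℝ) x₀,
            |H τ - H₀| ≤ C * τ ∧ |φ τ - φ₀| * (x₀ - τ) ≤ C) := by

  classical
  obtain ⟨ε, hε, hεJ⟩ := hJ'cpt.exists_cthickening_subset_open hJopen hJ'sub
  set M : ℝ := |K| + 1 with hMdef
  have hM : 0 < M := by positivity
  have hKM : K ≤ M := by linarith [le_abs_self K]
  set c : ℝ := 1 / (3 * δ) * (2 * M) with hc
  have hcpos : 0 < c := by positivity
  refine ⟨min ξ₀ (min 1 (ε / c)), ⟨by positivity, min_le_left _ _⟩, c, hcpos, ?_⟩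
  intro H₀ φ₀ x₀ hH₀ hx₀
  have hx0 : 0 < x₀ := hx₀.1
  have hxξ : x₀ < ξ₀ := hx₀.2.trans_le (min_le_left _ _)
  have hx1 : x₀ ≤ 1 := (hx₀.2.trans_le ((min_le_right _ _).trans (min_le_left _ _))).le
  have hxε : c * x₀ ≤ ε := by
    have := (hx₀.2.trans_le ((min_le_right _ _).trans (min_le_right _ _))).le
    rw [le_div_iff₀ hcpos] at this
    linarith
  have hball : ∀ h, |h - H₀| ≤ ε → h ∈ J := fun h hh =>
    hεJ (Metric.closedBall_subset_cthickening hH₀ ε (by simpa [Real.dist_eq] using hh))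
  set p : ℝ → ℝ := fun h => max (H₀ - ε) (min h (H₀ + ε)) with hpdef
  have hpJ : ∀ h, p h ∈ closure J := fun h => subset_closure (hball _ (by
    rw [abs_le]
    have h1 : H₀ - ε ≤ p h := le_max_left _ _
    have h2 : p h ≤ H₀ + ε := max_le (by linarith) (min_le_right _ _)
    constructor <;> linarith))
  have hp1 : ∀ h k, |p h - p k| ≤ |h - k| := by
    intro h k
    have h1 : |p h - p k| ≤ |min h (H₀ + ε) - min k (H₀ + ε)| := by
      simpa using abs_max_sub_max_le_max (H₀ - ε) (min h (H₀ + ε)) (H₀ - ε) (min k (H₀ + ε))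
    have h2 : |min h (H₀ + ε) - min k (H₀ + ε)| ≤ |h - k| := by
      simpa using abs_min_sub_min_le_max h (H₀ + ε) k (H₀ + ε)
    exact h1.trans h2
  have hpid : ∀ h, |h - H₀| ≤ ε → p h = h := by
    intro h hh
    rw [abs_le] at hh
    simp only [hpdef]
    rw [min_eq_left (by linarith), max_eq_right (by linarith)]
  have up : ∀ {a b : ℝ}, a ≤ K ∧ b ≤ K → a ≤ M ∧ b ≤ M :=
    fun h => ⟨h.1.trans hKM, h.2.trans hKM⟩
  obtain ⟨a1, a2, a3⟩ := aux_rhs M ξ₀ x₀ N ⟨hx0, hxξ⟩ hx1 (closure J) hJconv.closure Λ R U hUopen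
    hUsub V hVopen hVsub hΛ hR (fun q hq => up (hKΛ q hq)) (fun q hq => up (hKR q hq)) hM.le
    p hpJ hp1
  obtain ⟨b1, b2, b3⟩ := aux_rhs M ξ₀ x₀ (N + 1) ⟨hx0, hxξ⟩ hx1 (closure J) hJconv.closure Ω P U
    hUopen hUsub V hVopen hVsub hΩ hP (fun q hq => up (hKΩ q hq)) (fun q hq => up (hKP q hq)) hM.le
    p hpJ hp1
  set A : ℝ → ℝ × ℝ → ℝ := fun t y =>
    Λ (p y.1, x₀ - t) + (x₀ - t) ^ N * R (p y.1, y.2, x₀ - t) with hA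
  set B : ℝ → ℝ × ℝ → ℝ := fun t y =>
    Ω (p y.1, x₀ - t) + (x₀ - t) ^ (N + 1) * P (p y.1, y.2, x₀ - t) with hB
  replace a1 : ∀ t ∈ Set.Ico 0 x₀, ∀ y, |A t y| ≤ 2 * M := a1
  replace b1 : ∀ t ∈ Set.Ico 0 x₀, ∀ y, |B t y| ≤ 2 * M := b1
  replace a2 : ∀ t ∈ Set.Ico 0 x₀, ∀ y z, |A t y - A t z| ≤ 2 * M * ‖y - z‖ := a2
  replace b2 : ∀ t ∈ Set.Ico 0 x₀, ∀ y z, |B t y - B t z| ≤ 2 * M * ‖y - z‖ := b2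
  replace a3 : ∀ y, ContinuousOn (fun t => A t y) (Set.Ico 0 x₀) := a3
  replace b3 : ∀ y, ContinuousOn (fun t => B t y) (Set.Ico 0 x₀) := b3
  clear_value A B
  obtain ⟨α, hα0, hα⟩ := aux_global_ode
    (fun t y => ((1 / (3 * δ)) * ((x₀ - t) * A t y), (1 / (3 * δ * (x₀ - t) ^ 2)) * B t y))
    x₀ hx0 (H₀, φ₀) (by
      intro y
      have c1 := a3 y
      have c2 := b3 y
      have c3 : ContinuousOn (fun t : ℝ => 1 / (3 * δ * (x₀ - t) ^ 2)) (Set.Ico 0 x₀) := by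
        refine ContinuousOn.div (by fun_prop) (by fun_prop) ?_
        intro t ht
        have : 0 < x₀ - t := by linarith [ht.2]
        positivity
      fun_prop) (by
      intro T hT
      have hxT : 0 < x₀ - T := by linarith [hT.2]
      set D : ℝ := 1 / (3 * δ) + 1 / (3 * δ * (x₀ - T) ^ 2) with hD
      have hDpos : 0 ≤ D * (2 * M) := by positivity
      have e1 : ∀ t ∈ Set.Icc 0 T, ∀ u v : ℝ, 0 ≤ v → |u| ≤ 2 * M * v →
          |(1 / (3 * δ)) * ((x₀ - t) * u)| ≤ D * (2 * M) * v := by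
        intro t ht u v hv hu
        have ht1 : 0 ≤ x₀ - t := by linarith [ht.2]
        have ht2 : x₀ - t ≤ 1 := by linarith [ht.1]
        rw [abs_mul, abs_mul, abs_of_nonneg ht1, abs_of_nonneg (by positivity)]
        calc 1 / (3 * δ) * ((x₀ - t) * |u|) ≤ 1 / (3 * δ) * (1 * (2 * M * v)) := by gcongr
          _ ≤ D * (1 * (2 * M * v)) := by
            have : 1 / (3 * δ) ≤ D := by rw [hD]; linarith [show 0 ≤ 1 / (3 * δ * (x₀ - T) ^ 2) by positivity]
            gcongr
          _ = D * (2 * M) * v := by ring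
      have e2 : ∀ t ∈ Set.Icc 0 T, ∀ u v : ℝ, 0 ≤ v → |u| ≤ 2 * M * v →
          |(1 / (3 * δ * (x₀ - t) ^ 2)) * u| ≤ D * (2 * M) * v := by
        intro t ht u v hv hu
        have ht1 : x₀ - T ≤ x₀ - t := by linarith [ht.2]
        rw [abs_mul, abs_of_nonneg (by positivity)]
        calc 1 / (3 * δ * (x₀ - t) ^ 2) * |u|
            ≤ 1 / (3 * δ * (x₀ - T) ^ 2) * (2 * M * v) := by gcongr
          _ ≤ D * (2 * M * v) := by
            have : 1 / (3 * δ * (x₀ - T) ^ 2) ≤ D := by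
              rw [hD]; linarith [show 0 ≤ 1 / (3 * δ) by positivity]
            gcongr
          _ = D * (2 * M) * v := by ring
      refine ⟨⟨D * (2 * M), hDpos⟩, fun t ht => ?_⟩
      have ht' : t ∈ Set.Ico 0 x₀ := ⟨ht.1, ht.2.trans_lt hT.2⟩
      constructor
      · intro y
        have h1 := e1 t ht (A t y) 1 zero_le_one (by simpa using a1 t ht' y)
        have h2 := e2 t ht (B t y) 1 zero_le_one (by simpa using b1 t ht' y)
        rw [mul_one] at h1 h2
        exact max_le h1 h2
      · refine LipschitzWith.of_dist_le_mul fun y z => ?_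
        have h1 := e1 t ht (A t y - A t z) ‖y - z‖ (norm_nonneg _) (a2 t ht' y z)
        have h2 := e2 t ht (B t y - B t z) ‖y - z‖ (norm_nonneg _) (b2 t ht' y z)
        rw [dist_eq_norm, dist_eq_norm, Prod.mk_sub_mk, ← mul_sub, ← mul_sub, ← mul_sub]
        exact max_le h1 h2)
  have hαH : ∀ t ∈ Set.Ico 0 x₀, HasDerivWithinAt (fun t => (α t).1)
      ((1 / (3 * δ)) * ((x₀ - t) * A t (α t))) (Set.Ici 0) t := fun t ht => (hα t ht).fst
  have hαφ : ∀ t ∈ Set.Ico 0 x₀, HasDerivWithinAt (fun t => (α t).2)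
      ((1 / (3 * δ * (x₀ - t) ^ 2)) * B t (α t)) (Set.Ici 0) t := fun t ht => (hα t ht).snd
  have hcH : ContinuousOn (fun t => (α t).1) (Set.Ico 0 x₀) := fun t ht =>
    (hαH t ht).continuousWithinAt.mono Set.Ico_subset_Ici_self
  have hcφ : ContinuousOn (fun t => (α t).2) (Set.Ico 0 x₀) := fun t ht =>
    (hαφ t ht).continuousWithinAt.mono Set.Ico_subset_Ici_self
  have bH : ∀ τ ∈ Set.Ico 0 x₀, |(α τ).1 - H₀| ≤ c * τ := by
    intro τ hτ
    have := norm_image_sub_le_of_norm_deriv_right_le_segment (a := 0) (b := τ) (C := c)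
      (f := fun t => (α t).1) (f' := fun t => (1 / (3 * δ)) * ((x₀ - t) * A t (α t)))
      (hcH.mono (Set.Icc_subset_Ico_right hτ.2))
      (fun t ht => (hαH t ⟨ht.1, ht.2.trans hτ.2⟩).mono (Set.Ici_subset_Ici.2 ht.1))
      (by
        intro t ht
        have ht' : t ∈ Set.Ico 0 x₀ := ⟨ht.1, ht.2.trans hτ.2⟩
        have ht1 : 0 ≤ x₀ - t := by linarith [ht'.2]
        have ht2 : x₀ - t ≤ 1 := by linarith [ht.1]
        have h1 := a1 t ht' (α t)
        rw [Real.norm_eq_abs, abs_mul, abs_mul, abs_of_nonneg ht1, abs_of_nonneg (by positivity)]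
        calc 1 / (3 * δ) * ((x₀ - t) * |A t (α t)|) ≤ 1 / (3 * δ) * (1 * (2 * M)) := by gcongr
          _ = c := by rw [hc]; ring)
      τ ⟨hτ.1, le_rfl⟩
    simpa [hα0] using this
  have bφ : ∀ τ ∈ Set.Ico 0 x₀, |(α τ).2 - φ₀| * (x₀ - τ) ≤ c := by
    intro τ hτ
    have hpos : ∀ t ∈ Set.Icc 0 τ, 0 < x₀ - t := fun t ht => by linarith [ht.2, hτ.2]
    have hBd : ∀ t ∈ Set.Icc 0 τ,
        HasDerivAt (fun t => c / (x₀ - t)) (c / (x₀ - t) ^ 2) t := by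
      intro t ht
      have h1 : HasDerivAt (fun t => x₀ - t) (-1) t := by
        simpa using (hasDerivAt_id t).const_sub x₀
      have h2 := (hasDerivAt_const t c).div h1 (hpos t ht).ne'
      have h3 : (0 * (x₀ - t) - c * -1) / (x₀ - t) ^ 2 = c / (x₀ - t) ^ 2 := by ring
      rw [h3] at h2
      exact h2
    have := image_norm_le_of_norm_deriv_right_le_deriv_boundary' (a := 0) (b := τ)
      (f := fun t => (α t).2 - φ₀) (f' := fun t => (1 / (3 * δ * (x₀ - t) ^ 2)) * B t (α t))
      (B := fun t => c / (x₀ - t)) (B' := fun t => c / (x₀ - t) ^ 2)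
      ((hcφ.mono (Set.Icc_subset_Ico_right hτ.2)).sub continuousOn_const)
      (fun t ht => ((hαφ t ⟨ht.1, ht.2.trans hτ.2⟩).mono (Set.Ici_subset_Ici.2 ht.1)).sub_const _)
      (by simp [hα0]; positivity)
      (fun t ht => (hBd t ht).continuousAt.continuousWithinAt)
      (fun t ht => (hBd t ⟨ht.1, ht.2.le⟩).hasDerivWithinAt)
      (by
        intro t ht
        have h1 := b1 t ⟨ht.1, ht.2.trans hτ.2⟩ (α t)
        have h2 := hpos t ⟨ht.1, ht.2.le⟩
        rw [Real.norm_eq_abs, abs_mul, abs_of_nonneg (by positivity)]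
        calc 1 / (3 * δ * (x₀ - t) ^ 2) * |B t (α t)|
            ≤ 1 / (3 * δ * (x₀ - t) ^ 2) * (2 * M) := by gcongr
          _ = c / (x₀ - t) ^ 2 := by rw [hc]; field_simp)
      (x := τ) ⟨hτ.1, le_rfl⟩
    exact (le_div_iff₀ (hpos τ ⟨hτ.1, le_rfl⟩)).1 this
  have bε : ∀ τ ∈ Set.Ico 0 x₀, |(α τ).1 - H₀| ≤ ε := fun τ hτ =>
    (bH τ hτ).trans ((mul_le_mul_of_nonneg_left hτ.2.le hcpos.le).trans hxε)
  refine ⟨fun t => (α t).1, fun t => (α t).2, by simp [hα0], by simp [hα0], hcH, hcφ,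
    fun τ hτ => hball _ (bε τ hτ), fun τ hτ => ?_, fun τ hτ => ⟨bH τ hτ, bφ τ hτ⟩⟩
  have hτ' : τ ∈ Set.Ico 0 x₀ := ⟨hτ.1.le, hτ.2⟩
  have h1 := (hαH τ hτ').hasDerivAt (Ici_mem_nhds hτ.1)
  have h2 := (hαφ τ hτ').hasDerivAt (Ici_mem_nhds hτ.1)
  simp only [hA, hB, hpid _ (bε τ hτ')] at h1 h2
  exact ⟨h1, h2⟩
end

section
/- Let δ ∈ ℝ and define X : ℝ³ → ℝ³ by X(r, v, l) = (v·r³, l⁴ − r·l² − 2δ·r³·v·l, −δ·r³·l²). Then for every point p ∈ ℝ³ lying in V ∪ P, where V := {(r,v,l) : r = 0 and l = 0} and P := {(r,v,l) : v = 0 and l = 0}, one has X(p) = 0, and the Jacobian matrix D of X at p satisfies D² = 0; in particular the characteristic polynomial of D is λ³ and every complex eigenvalue of D is 0 (p is a completely degenerate equilibrium). -/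
/-- The vector field of the desingularized Kepler problem with linear drag,
in coordinates `p = (r, v, l)`. -/
noncomputable def keplerFieldRVL (δ : ℝ) (p : Fin 3 → ℝ) : Fin 3 → ℝ :=
  ![p 1 * (p 0) ^ 3,
    (p 2) ^ 4 - p 0 * (p 2) ^ 2 - 2 * δ * (p 0) ^ 3 * p 1 * p 2,
    -δ * (p 0) ^ 3 * (p 2) ^ 2]

/-- Every point of `V ∪ P`, where `V = {r = l = 0}` and `P = {v = l = 0}`, is a
completely degenerate equilibrium: the field vanishes there and its Jacobian matrix `D`
satisfies `D² = 0`; in particular the characteristic polynomial of `D` is `λ³` and all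
complex eigenvalues of `D` vanish. -/
theorem completely_degenerate_equilibria (δ : ℝ) :
    ∀ p : Fin 3 → ℝ, ((p 0 = 0 ∧ p 2 = 0) ∨ (p 1 = 0 ∧ p 2 = 0)) →
      keplerFieldRVL δ p = 0 ∧
      ∃ D : Matrix (Fin 3) (Fin 3) ℝ,
        HasFDerivAt (keplerFieldRVL δ)
          (LinearMap.toContinuousLinearMap (Matrix.toLin' D)) p ∧
        D * D = 0 ∧
        D.charpoly = Polynomial.X ^ 3 ∧
        ∀ z ∈ spectrum ℂ (D.map (fun x : ℝ => (x : ℂ))), z = 0 := by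
  intro p hp
  have h2 : p 2 = 0 := by rcases hp with h | h <;> exact h.2
  have h01 : p 0 = 0 ∨ p 1 = 0 := hp.imp (fun h => h.1) (fun h => h.1)
  refine ⟨?_, !![0, (p 0) ^ 3, 0; 0, 0, 0; 0, 0, 0], ?_, ?_, ?_, ?_⟩
  · ext i
    fin_cases i <;> rcases h01 with h | h <;> simp [keplerFieldRVL, h, h2]
  · have e : ∀ i : Fin 3, HasFDerivAt (fun q : Fin 3 → ℝ => q i)
        (ContinuousLinearMap.proj (R := ℝ) (φ := fun _ : Fin 3 => ℝ) i) p :=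
      fun i => hasFDerivAt_apply i p
    rw [hasFDerivAt_pi']
    intro i
    fin_cases i
    · refine ((e 1).mul ((e 0).pow 3)).congr_fderiv ?_
      ext x
      rcases h01 with h | h <;>
        simp [h, Matrix.toLin'_apply, Matrix.mulVec, dotProduct, Fin.sum_univ_three]
    · refine ((((e 2).pow 4).sub ((e 0).mul ((e 2).pow 2))).sub
        (((((e 0).pow 3).const_mul (2 * δ)).mul (e 1)).mul (e 2))).congr_fderiv ?_
      ext x
      rcases h01 with h | h <;>
        simp [h, h2, Matrix.toLin'_apply, Matrix.mulVec, dotProduct, Fin.sum_univ_three]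
    · refine ((((e 0).pow 3).const_mul (-δ)).mul ((e 2).pow 2)).congr_fderiv ?_
      ext x
      simp [h2, Matrix.toLin'_apply, Matrix.mulVec, dotProduct, Fin.sum_univ_three]
  · ext i j
    fin_cases i <;> fin_cases j <;> simp [Matrix.mul_apply, Fin.sum_univ_three]
  · rw [Matrix.charpoly, Matrix.det_fin_three]
    simp [Matrix.charmatrix_apply]
    try ring
  · intro z hz
    by_contra hne
    apply hz
    rw [spectrum.mem_resolventSet_iff, Matrix.isUnit_iff_isUnit_det, Matrix.det_fin_three]
    simp [Matrix.algebraMap_matrix_apply, hne]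
end

section
/- Let (v, l₂) : I → ℝ² be differentiable on an interval I and satisfy v'(t) = l₂(t)²·(l₂(t)² − 1) and l₂'(t) = −½·l₂(t)·v(t) on I. Then the function H₂(l₂(t), v(t)) is constant on I, where H₂(l₂, v) := ½v² + ½ − l₂² + ½l₂⁴. -/
/-- The function `H₂(l₂,v) = ½v² + ½ - l₂² + ½l₂⁴` is a first integral of the planar
system `v' = l₂²(l₂² - 1)`, `l₂' = -½l₂v`. -/
theorem H2_conserved
    (I : Set ℝ) (hI : Convex ℝ I) (v l₂ : ℝ → ℝ)
    (hv : ∀ t ∈ I, HasDerivAt v ((l₂ t) ^ 2 * ((l₂ t) ^ 2 - 1)) t)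
    (hl₂ : ∀ t ∈ I, HasDerivAt l₂ (-(1 / 2) * l₂ t * v t) t) :
    ∀ t ∈ I, ∀ t₀ ∈ I,
      (1 / 2) * (v t) ^ 2 + 1 / 2 - (l₂ t) ^ 2 + (1 / 2) * (l₂ t) ^ 4 =
        (1 / 2) * (v t₀) ^ 2 + 1 / 2 - (l₂ t₀) ^ 2 + (1 / 2) * (l₂ t₀) ^ 4 := by
  intro t ht t₀ ht₀
  have key : ∀ s ∈ I, HasDerivWithinAt
      (fun s => (1 / 2) * (v s) ^ 2 + 1 / 2 - (l₂ s) ^ 2 + (1 / 2) * (l₂ s) ^ 4) 0 I s := by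
    intro s hs
    have h := (((((hv s hs).pow 2).const_mul (1 / 2 : ℝ)).add_const (1 / 2 : ℝ)).sub
      ((hl₂ s hs).pow 2)).add (((hl₂ s hs).pow 4).const_mul (1 / 2 : ℝ))
    refine HasDerivAt.hasDerivWithinAt (h.congr_deriv ?_)
    push_cast
    ring
  have hb := hI.norm_image_sub_le_of_norm_hasDerivWithin_le (C := 0) key
    (fun s _ => by simp) ht₀ ht
  rw [zero_mul] at hb
  exact sub_eq_zero.mp (norm_le_zero_iff.mp hb)
end

section
/- Let δ ∈ ℝ and define X : ℝ³ → ℝ³ by X(ρ₂, v₁, μ₁) = (½·ρ₂·v₁, μ₁² + ½·v₁² − 1 − δ·ρ₂³·v₁, −(½·v₁ + δ·ρ₂³)·μ₁). Then X(0, √2, 0) = 0 and X(0, −√2, 0) = 0, and the Jacobian matrices of X at these points are the diagonal matrices diag(√2/2, √2, −√2/2) and diag(−√2/2, −√2, √2/2), respectively. In particular, both equilibria are hyperbolic saddles: all eigenvalues of each linearization are real and nonzero, and each linearization has eigenvalues of both signs. -/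
/-- The desingularized vector field in the blowup chart `(ρ₂, v₁, μ₁)`. -/
noncomputable def keplerFieldChart21 (δ : ℝ) (p : Fin 3 → ℝ) : Fin 3 → ℝ :=
  ![(1 / 2) * p 0 * p 1,
    (p 2) ^ 2 + (1 / 2) * (p 1) ^ 2 - 1 - δ * (p 0) ^ 3 * p 1,
    -((1 / 2) * p 1 + δ * (p 0) ^ 3) * p 2]

theorem kepler_aux_zero (δ s : ℝ) (hs : s ^ 2 = 2) : keplerFieldChart21 δ ![0, s, 0] = 0 := by
  ext i
  fin_cases i <;> simp [keplerFieldChart21, hs]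

theorem kepler_aux_deriv (δ s : ℝ) :
    HasFDerivAt (keplerFieldChart21 δ)
      (LinearMap.toContinuousLinearMap (Matrix.toLin'
        (Matrix.diagonal ![s / 2, s, -(s / 2)]))) ![0, s, 0] := by
  have h (i : Fin 3) : HasFDerivAt (fun p : Fin 3 → ℝ => p i)
      (ContinuousLinearMap.proj (R := ℝ) (φ := fun _ : Fin 3 => ℝ) i) ![0, s, 0] :=
    hasFDerivAt_apply i _
  rw [hasFDerivAt_pi']
  intro i
  fin_cases i
  · refine (((h 0).const_mul (1 / 2)).mul (h 1)).congr_fderiv ?_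
    ext v
    simp [Matrix.mulVec_diagonal]
    try ring
  · refine (((((h 2).pow 2).add (((h 1).pow 2).const_mul (1 / 2))).sub_const 1).sub
      ((((h 0).pow 3).const_mul δ).mul (h 1))).congr_fderiv ?_
    ext v
    simp [Matrix.mulVec_diagonal]
    try ring
  · refine ((((h 1).const_mul (1 / 2)).add (((h 0).pow 3).const_mul δ)).neg.mul (h 2)).congr_fderiv ?_
    ext v
    simp [Matrix.mulVec_diagonal]
    left
    ring

theorem kepler_aux_spec (d : Fin 3 → ℝ) (z : ℂ) :
    z ∈ spectrum ℂ ((Matrix.diagonal d).map (fun x : ℝ => (x : ℂ))) ↔ ∃ i, (d i : ℂ) = z := by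
  rw [Matrix.diagonal_map (by simp), spectrum_diagonal]
  simp

/-- The points `γ₂₁^± = (0, ±√2, 0)` are equilibria whose Jacobians are the diagonal
matrices `diag(√2/2, √2, -√2/2)` and `diag(-√2/2, -√2, √2/2)`; in particular both are
hyperbolic saddles: all eigenvalues are real and nonzero, with both signs present. -/
theorem hyperbolic_saddles_gamma21 (δ : ℝ) :
    keplerFieldChart21 δ ![0, Real.sqrt 2, 0] = 0 ∧
    keplerFieldChart21 δ ![0, -Real.sqrt 2, 0] = 0 ∧
    HasFDerivAt (keplerFieldChart21 δ)
      (LinearMap.toContinuousLinearMap (Matrix.toLin'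
        (Matrix.diagonal ![Real.sqrt 2 / 2, Real.sqrt 2, -(Real.sqrt 2 / 2)])))
      ![0, Real.sqrt 2, 0] ∧
    HasFDerivAt (keplerFieldChart21 δ)
      (LinearMap.toContinuousLinearMap (Matrix.toLin'
        (Matrix.diagonal ![-(Real.sqrt 2 / 2), -Real.sqrt 2, Real.sqrt 2 / 2])))
      ![0, -Real.sqrt 2, 0] ∧
    (∀ z ∈ spectrum ℂ
        ((Matrix.diagonal ![Real.sqrt 2 / 2, Real.sqrt 2, -(Real.sqrt 2 / 2)]).map
          (fun x : ℝ => (x : ℂ))),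
      z.im = 0 ∧ z ≠ 0) ∧
    (∃ z ∈ spectrum ℂ
        ((Matrix.diagonal ![Real.sqrt 2 / 2, Real.sqrt 2, -(Real.sqrt 2 / 2)]).map
          (fun x : ℝ => (x : ℂ))), 0 < z.re) ∧
    (∃ z ∈ spectrum ℂ
        ((Matrix.diagonal ![Real.sqrt 2 / 2, Real.sqrt 2, -(Real.sqrt 2 / 2)]).map
          (fun x : ℝ => (x : ℂ))), z.re < 0) ∧
    (∀ z ∈ spectrum ℂ
        ((Matrix.diagonal ![-(Real.sqrt 2 / 2), -Real.sqrt 2, Real.sqrt 2 / 2]).map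
          (fun x : ℝ => (x : ℂ))),
      z.im = 0 ∧ z ≠ 0) ∧
    (∃ z ∈ spectrum ℂ
        ((Matrix.diagonal ![-(Real.sqrt 2 / 2), -Real.sqrt 2, Real.sqrt 2 / 2]).map
          (fun x : ℝ => (x : ℂ))), 0 < z.re) ∧
    (∃ z ∈ spectrum ℂ
        ((Matrix.diagonal ![-(Real.sqrt 2 / 2), -Real.sqrt 2, Real.sqrt 2 / 2]).map
          (fun x : ℝ => (x : ℂ))), z.re < 0) := by
  have hp : 0 < Real.sqrt 2 := by positivity
  have hs : Real.sqrt 2 ^ 2 = 2 := by norm_num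
  refine ⟨kepler_aux_zero δ _ hs, kepler_aux_zero δ _ (by rw [neg_sq, hs]),
    kepler_aux_deriv δ _, ?_, ?_, ?_, ?_, ?_, ?_, ?_⟩
  · have := kepler_aux_deriv δ (-Real.sqrt 2)
    rwa [neg_div, neg_neg] at this
  · intro z hz
    obtain ⟨i, rfl⟩ := (kepler_aux_spec _ _).1 hz
    refine ⟨Complex.ofReal_im _, Complex.ofReal_ne_zero.2 ?_⟩
    fin_cases i <;> simp
  · exact ⟨_, (kepler_aux_spec _ _).2 ⟨1, rfl⟩, by simp⟩
  · exact ⟨_, (kepler_aux_spec _ _).2 ⟨2, rfl⟩, by rw [Complex.ofReal_re]; simp⟩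
  · intro z hz
    obtain ⟨i, rfl⟩ := (kepler_aux_spec _ _).1 hz
    refine ⟨Complex.ofReal_im _, Complex.ofReal_ne_zero.2 ?_⟩
    fin_cases i <;> simp
  · exact ⟨_, (kepler_aux_spec _ _).2 ⟨2, rfl⟩, by rw [Complex.ofReal_re]; simp⟩
  · exact ⟨_, (kepler_aux_spec _ _).2 ⟨1, rfl⟩, by simp⟩
end
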